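/- arXiv:2311.04045 — 4 statements merged into one kernel-verified Lean document; each statement's English description precedes it below -/
import Mathlib

section
/- Let ν be a Lévy measure with tail ν̄ and Laplace exponent Φ(q) = βq + ∫₀^∞(1−e^{−qu})ν(du), β ≥ 0. Assume that x ↦ xΦ(e^{−x}) is regularly varying at ∞ with index 1−δ for some δ ∈ [0,1] and is asymptotically equivalent at ∞ to a nondecreasing function. Then there exists a function φ:(0,∞)→(0,∞) such that: (1) φ(1/y)/Φ(1/y) → 1 as y → ∞; (2) the function h(x) := log(1/φ(e^{−eˣ})) is C^∞ on ℝ and satisfies h'(x) → δ and h^{(n)}(x) → 0 for every n ≥ 2, as x → ∞; (3) φ is strictly increasing; (4) x ↦ xφ(e^{−x}) is nondecreasing on (0,∞). -/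
open Real MeasureTheory Filter Set Topology

lemma aux_conv_tendsto (ψ M : ℝ → ℝ) (hψ : Continuous ψ) (hψc : HasCompactSupport ψ)
    (hM : Monotone M) (γ : ℝ) (hlim : ∀ t, Tendsto (fun x => M (x + t) - M x) atTop (𝓝 (γ * t))) :
    Tendsto (fun x => (convolution ψ M (ContinuousLinearMap.mul ℝ ℝ) volume) x - M x * ∫ t, ψ t)
      atTop (𝓝 (-γ * ∫ t, t * ψ t)) := by
  have hint : Integrable ψ := hψ.integrable_of_hasCompactSupport hψc
  have hMl : LocallyIntegrable M := hM.locallyIntegrable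
  have key : ∀ x, (convolution ψ M (ContinuousLinearMap.mul ℝ ℝ) volume) x - M x * ∫ t, ψ t
      = ∫ t, ψ t * (M (x - t) - M x) := by
    intro x
    have hi : Integrable (fun t => ψ t * M (x - t)) := by
      have := hψc.convolutionExists_left (ContinuousLinearMap.mul ℝ ℝ) hψ hMl x
      exact this
    simp only [convolution, ContinuousLinearMap.mul_apply']
    rw [← integral_const_mul, ← integral_sub hi (hint.const_mul _)]
    congr 1; ext t; ring
  simp only [key]
  rw [← integral_const_mul]
  obtain ⟨R, hR⟩ := hψc.isCompact.isBounded.subset_closedBall 0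
  have hmeas : Measurable M := hM.measurable
  refine tendsto_integral_filter_of_dominated_convergence
    (fun t => |ψ t| * (γ * R - γ * (-R) + 1)) ?_ ?_ ?_ ?_
  · refine Eventually.of_forall fun x => ?_
    exact (hψ.measurable.mul ((hmeas.comp (measurable_const.sub measurable_id)).sub
      measurable_const)).aestronglyMeasurable
  · have h1 := (hlim R).sub (hlim (-R))
    filter_upwards [h1.eventually (gt_mem_nhds (lt_add_one _))] with x hx
    refine Eventually.of_forall fun t => ?_
    by_cases ht : ψ t = 0
    · simp [ht]
    have htR : t ∈ Metric.closedBall (0:ℝ) R := hR (subset_tsupport _ ht)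
    rw [Metric.mem_closedBall, dist_zero_right, Real.norm_eq_abs, abs_le] at htR
    rw [Real.norm_eq_abs, abs_mul]
    refine mul_le_mul_of_nonneg_left ?_ (abs_nonneg _)
    have a1 := hM (show x - t ≤ x + R by linarith)
    have a2 := hM (show x + -R ≤ x - t by linarith)
    have a3 := hM (show x ≤ x + R by linarith)
    have a4 := hM (show x + -R ≤ x by linarith)
    rw [abs_le]; constructor <;> linarith
  · exact hint.abs.mul_const _
  · refine Eventually.of_forall fun t => ?_
    have := (hlim (-t)).const_mul (ψ t)
    have e : -γ * (t * ψ t) = ψ t * (γ * -t) := by ring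
    rw [e]
    simpa only [sub_eq_add_neg] using this

lemma aux_iter_conv (M : ℝ → ℝ) (hM : LocallyIntegrable M) (n : ℕ) :
    ∀ ψ : ℝ → ℝ, ContDiff ℝ (⊤ : ℕ∞) ψ → HasCompactSupport ψ →
    iteratedDeriv n (convolution ψ M (ContinuousLinearMap.mul ℝ ℝ) volume)
      = convolution (iteratedDeriv n ψ) M (ContinuousLinearMap.mul ℝ ℝ) volume := by
  induction n with
  | zero => intro ψ _ _; simp
  | succ n ih =>
    intro ψ h1 h2
    have h3 : deriv (convolution ψ M (ContinuousLinearMap.mul ℝ ℝ) volume)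
        = convolution (deriv ψ) M (ContinuousLinearMap.mul ℝ ℝ) volume := by
      ext x
      exact (h2.hasDerivAt_convolution_left (ContinuousLinearMap.mul ℝ ℝ)
        (h1.of_le (by exact_mod_cast le_top)) hM x).deriv
    rw [iteratedDeriv_succ', h3, iteratedDeriv_succ', ih _ (contDiff_infty_iff_deriv.1 h1).2 h2.deriv]

lemma aux_iter_supp (n : ℕ) : ∀ ψ : ℝ → ℝ, ContDiff ℝ (⊤ : ℕ∞) ψ → HasCompactSupport ψ →
    ContDiff ℝ (⊤ : ℕ∞) (iteratedDeriv n ψ) ∧ HasCompactSupport (iteratedDeriv n ψ) := by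
  induction n with
  | zero => intro ψ h1 h2; simpa using ⟨h1, h2⟩
  | succ n ih =>
    intro ψ h1 h2
    rw [iteratedDeriv_succ']
    exact ih _ (contDiff_infty_iff_deriv.1 h1).2 h2.deriv

lemma aux_int_deriv (ψ : ℝ → ℝ) (h1 : ContDiff ℝ (⊤ : ℕ∞) ψ) (h2 : HasCompactSupport ψ) :
    ∫ t, deriv ψ t = 0 ∧ ∫ t, t * deriv ψ t = - ∫ t, ψ t := by
  have hd : ∀ x, HasDerivAt ψ (deriv ψ x) x := fun x =>
    ((contDiff_infty_iff_deriv.1 h1).1 x).hasDerivAt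
  have hc := (contDiff_infty_iff_deriv.1 h1).2.continuous
  have hi : Integrable ψ := h1.continuous.integrable_of_hasCompactSupport h2
  have hi' : Integrable (deriv ψ) := hc.integrable_of_hasCompactSupport h2.deriv
  refine ⟨integral_eq_zero_of_hasDerivAt_of_integrable hd hi' hi, ?_⟩
  have := integral_mul_deriv_eq_deriv_mul_of_integrable (u := fun x : ℝ => x) (u' := fun _ => 1)
    (v := ψ) (v' := deriv ψ) (fun x _ => hasDerivAt_id x) (fun x _ => hd x)
    ((continuous_id.mul hc).integrable_of_hasCompactSupport (h2.deriv.mul_left))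
    (by simpa [Pi.mul_def] using hi)
    ((continuous_id.mul h1.continuous).integrable_of_hasCompactSupport (h2.mul_left))
  simpa using this

lemma aux_smooth (M : ℝ → ℝ)
    (hM : Monotone M) (γ : ℝ) (hlim : ∀ t, Tendsto (fun x => M (x + t) - M x) atTop (𝓝 (γ * t))) :
    ∃ m : ℝ → ℝ, ContDiff ℝ (⊤ : ℕ∞) m ∧ Tendsto (fun x => m x - M x) atTop (𝓝 0) ∧
      Tendsto (deriv m) atTop (𝓝 γ) ∧
      (∀ n : ℕ, 2 ≤ n → Tendsto (iteratedDeriv n m) atTop (𝓝 0)) ∧ ∀ x, 0 ≤ deriv m x := by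
  have hMl : LocallyIntegrable M := hM.locallyIntegrable
  let b : ContDiffBump (0:ℝ) := ⟨1, 2, one_pos, one_lt_two⟩
  set ρ : ℝ → ℝ := b.normed volume with hρ
  have h1 : ContDiff ℝ (⊤ : ℕ∞) ρ := b.contDiff_normed
  have h2 : HasCompactSupport ρ := b.hasCompactSupport_normed
  have hI : ∫ t, ρ t = 1 := b.integral_normed
  have hI0 : ∫ t, t * ρ t = 0 := by
    have h := integral_neg_eq_self (fun t => t * ρ t) volume
    have : ∀ t, -t * ρ (-t) = - (t * ρ t) := by
      intro t; rw [hρ, b.normed_neg]; ring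
    simp only [this] at h
    rw [integral_neg] at h
    linarith
  refine ⟨convolution ρ M (ContinuousLinearMap.mul ℝ ℝ) volume,
    h2.contDiff_convolution_left _ h1 hMl, ?_, ?_, ?_, ?_⟩
  · have := aux_conv_tendsto ρ M h1.continuous h2 hM γ hlim
    simpa [hI, hI0] using this
  · rw [← iteratedDeriv_one, aux_iter_conv M hMl 1 ρ h1 h2]
    have := aux_conv_tendsto _ M (aux_iter_supp 1 ρ h1 h2).1.continuous
      (aux_iter_supp 1 ρ h1 h2).2 hM γ hlim
    rw [iteratedDeriv_one] at this ⊢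
    simpa [(aux_int_deriv ρ h1 h2).1, (aux_int_deriv ρ h1 h2).2, hI] using this
  · intro n hn
    obtain ⟨k, rfl⟩ : ∃ k, n = k + 1 + 1 := ⟨n - 2, by omega⟩
    rw [aux_iter_conv M hMl _ ρ h1 h2]
    have := aux_conv_tendsto _ M (aux_iter_supp (k+1+1) ρ h1 h2).1.continuous
      (aux_iter_supp (k+1+1) ρ h1 h2).2 hM γ hlim
    obtain ⟨c1, c2⟩ := aux_iter_supp (k+1) ρ h1 h2
    obtain ⟨d1, d2⟩ := aux_iter_supp k ρ h1 h2
    have e : ∫ t, iteratedDeriv (k+1) ρ t = 0 := by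
      rw [iteratedDeriv_succ]; exact (aux_int_deriv _ d1 d2).1
    have e2 := aux_int_deriv _ c1 c2
    rw [← iteratedDeriv_succ, e] at e2
    simpa [e2.1, e2.2] using this
  · intro x
    refine Monotone.deriv_nonneg ?_
    intro x y hxy
    simp only [convolution, ContinuousLinearMap.mul_apply']
    refine integral_mono (h2.convolutionExists_left (ContinuousLinearMap.mul ℝ ℝ) h1.continuous hMl x)
      (h2.convolutionExists_left (ContinuousLinearMap.mul ℝ ℝ) h1.continuous hMl y) ?_
    intro t
    exact mul_le_mul_of_nonneg_left (hM (by linarith)) (b.nonneg_normed t)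

lemma aux_glue (h : ℝ → ℝ) (hs : ContDiff ℝ (⊤ : ℕ∞) h)
    (hd : ∀ᶠ x in atTop, 0 < deriv h x ∧ deriv h x ≤ 1) :
    ∃ g : ℝ → ℝ, ContDiff ℝ (⊤ : ℕ∞) g ∧ (∃ X, ∀ x ≥ X, g x = h x) ∧
      (∀ x, 0 < deriv g x ∧ deriv g x ≤ 1) ∧ ∃ c, ∀ x, c < g x := by
  obtain ⟨X, hX⟩ := eventually_atTop.1 hd
  have hds := contDiff_infty_iff_deriv.1 hs
  set p : ℝ → ℝ := fun x => smoothTransition (x - X) * deriv h x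
    + (1 - smoothTransition (x - X)) * exp (x - X - 1) with hp
  have hst : ContDiff ℝ (⊤ : ℕ∞) (fun x => smoothTransition (x - X)) :=
    smoothTransition.contDiff.comp (contDiff_id.sub contDiff_const)
  have hps : ContDiff ℝ (⊤ : ℕ∞) p := by
    refine (hst.mul hds.2).add ((contDiff_const.sub hst).mul ?_)
    exact ((contDiff_id.sub contDiff_const).sub contDiff_const).exp
  have hpb : ∀ x, 0 < p x ∧ p x ≤ 1 := by
    intro x
    rcases le_or_gt x X with hx | hx
    · have : smoothTransition (x - X) = 0 := smoothTransition.zero_of_nonpos (by linarith)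
      simp only [hp, this]
      have : exp (x - X - 1) ≤ 1 := exp_le_one_iff.2 (by linarith)
      have := exp_pos (x - X - 1)
      constructor <;> linarith
    rcases le_or_gt (X + 1) x with hx1 | hx1
    · have : smoothTransition (x - X) = 1 := smoothTransition.one_of_one_le (by linarith)
      simp only [hp, this]
      have := hX x hx.le
      constructor <;> linarith
    · have h0 := smoothTransition.pos_of_pos (show 0 < x - X by linarith)
      have h1 := smoothTransition.le_one (x - X)
      have e1 : exp (x - X - 1) ≤ 1 := exp_le_one_iff.2 (by linarith)
      have e2 := exp_pos (x - X - 1)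
      obtain ⟨d1, d2⟩ := hX x hx.le
      simp only [hp]
      constructor
      · have := mul_pos h0 d1
        have := mul_nonneg (sub_nonneg.2 h1) e2.le
        linarith
      · nlinarith
  set g : ℝ → ℝ := fun x => h (X + 1) + ∫ t in (X+1)..x, p t with hg
  have hgd : ∀ x, HasDerivAt g (p x) x := fun x =>
    ((hps.continuous.integral_hasStrictDerivAt (X+1) x).hasDerivAt).const_add _
  have hgd' : deriv g = p := funext fun x => (hgd x).deriv
  have hgm : StrictMono g := strictMono_of_deriv_pos fun x => by rw [hgd']; exact (hpb x).1
  refine ⟨g, ?_, ⟨X + 1, ?_⟩, ?_, ?_⟩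
  · rw [contDiff_infty_iff_deriv, hgd']
    exact ⟨fun x => (hgd x).differentiableAt, hps⟩
  · intro x hx
    have : ∫ t in (X+1)..x, p t = ∫ t in (X+1)..x, deriv h t := by
      refine intervalIntegral.integral_congr fun t ht => ?_
      rw [uIcc_of_le hx] at ht
      have : smoothTransition (t - X) = 1 := smoothTransition.one_of_one_le (by linarith [ht.1])
      simp [hp, this]
    simp only [hg]
    rw [this, intervalIntegral.integral_deriv_eq_sub (fun x _ => hds.1 x)
      (hds.2.continuous.intervalIntegrable _ _)]
    ring
  · intro x; rw [hgd']; exact hpb x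
  · have hF : ∀ x, HasDerivAt (fun x => g x - exp (x - X - 1)) (p x - exp (x - X - 1)) x := by
      intro x
      have := (((hasDerivAt_id x).sub_const X).sub_const 1).exp
      simpa using (hgd x).fun_sub this
    have hanti : AntitoneOn (fun x => g x - exp (x - X - 1)) (Iic X) := by
      refine antitoneOn_of_deriv_nonpos (convex_Iic X)
        (fun x _ => (hF x).continuousAt.continuousWithinAt)
        (fun x _ => (hF x).differentiableAt.differentiableWithinAt) ?_
      intro x hx
      rw [interior_Iic] at hx
      have : smoothTransition (x - X) = 0 := smoothTransition.zero_of_nonpos (by linarith [mem_Iio.1 hx])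
      rw [(hF x).deriv]
      simp [hp, this]
    refine ⟨g X - exp (X - X - 1), fun x => ?_⟩
    rcases le_or_gt x X with hx | hx
    · have := hanti (mem_Iic.2 hx) (mem_Iic.2 le_rfl) hx
      simp only at this
      have := exp_pos (x - X - 1)
      linarith
    · have := hgm hx
      have := exp_pos (X - X - 1)
      linarith

lemma aux_core (g K : ℝ → ℝ) (hg : Monotone g) (hK : Monotone K) (δ : ℝ) (hδ0 : 0 ≤ δ)
    (hδ1 : δ ≤ 1) (hlim : ∀ t, Tendsto (fun x => g (x + t) - g x) atTop (𝓝 (δ * t)))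
    (hKg : Tendsto (fun x => x - g x - K x) atTop (𝓝 0)) :
    ∃ h : ℝ → ℝ, ContDiff ℝ (⊤ : ℕ∞) h ∧ Tendsto (fun x => h x - g x) atTop (𝓝 0) ∧
      Tendsto (deriv h) atTop (𝓝 δ) ∧
      (∀ n : ℕ, 2 ≤ n → Tendsto (iteratedDeriv n h) atTop (𝓝 0)) ∧
      ∀ᶠ x in atTop, 0 < deriv h x ∧ deriv h x ≤ 1 := by
  rcases hδ1.lt_or_eq with hlt | heq
  · obtain ⟨m, hm, hmg, hm1, hmn, hm0⟩ := aux_smooth g hg δ hlim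
    have hexp : ContDiff ℝ (⊤ : ℕ∞) (fun x : ℝ => exp (-x)) := contDiff_neg.exp
    have hexp0 : Tendsto (fun x : ℝ => exp (-x)) atTop (𝓝 0) := tendsto_exp_neg_atTop_nhds_zero
    have hder : deriv (fun x => m x - exp (-x)) = fun x => deriv m x + exp (-x) := by
      ext x
      have h1 := ((contDiff_infty_iff_deriv.1 hm).1 x).hasDerivAt
      have h2 := (hasDerivAt_neg x).exp
      rw [(h1.fun_sub h2).deriv]
      ring
    have hd : Tendsto (deriv (fun x => m x - exp (-x))) atTop (𝓝 δ) := by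
      rw [hder]; simpa using hm1.add hexp0
    refine ⟨fun x => m x - exp (-x), hm.sub hexp, ?_, hd, ?_, ?_⟩
    · have := hmg.sub hexp0
      simp only [sub_zero] at this
      refine this.congr fun x => ?_
      ring
    · intro n hn
      have e : iteratedDeriv n (fun x => m x - exp (-x))
          = fun x => iteratedDeriv n m x - (-1) ^ n * exp (-x) := by
        ext x
        rw [iteratedDeriv_fun_sub (hm.contDiffAt.of_le (by exact_mod_cast le_top))
          (hexp.contDiffAt.of_le (by exact_mod_cast le_top)), iteratedDeriv_comp_neg n Real.exp x]
        simp [iteratedDeriv_eq_iterate]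
      rw [e]
      simpa using (hmn n hn).sub (hexp0.const_mul ((-1) ^ n))
    · filter_upwards [hd.eventually (gt_mem_nhds hlt)] with x hx
      refine ⟨?_, hx.le⟩
      rw [hder]
      have := hm0 x
      have := exp_pos (-x)
      simp only
      linarith
  · subst heq
    have hlimK : ∀ t, Tendsto (fun x => K (x + t) - K x) atTop (𝓝 (0 * t)) := by
      intro t
      have h1 := hKg.comp (tendsto_atTop_add_const_right atTop t tendsto_id)
      have := ((hKg.sub h1).sub (hlim t)).const_add t
      have e : t + (0 - 0 - 1 * t) = 0 * t := by ring
      rw [e] at this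
      refine this.congr fun x => ?_
      simp only [Function.comp, id]
      ring
    obtain ⟨m, hm, hmg, hm1, hmn, hm0⟩ := aux_smooth K hK 0 hlimK
    have hder : deriv (fun x => x - m x) = fun x => 1 - deriv m x := by
      ext x
      have h1 := ((contDiff_infty_iff_deriv.1 hm).1 x).hasDerivAt
      exact ((hasDerivAt_id' x).fun_sub h1).deriv
    have hd : Tendsto (deriv (fun x => x - m x)) atTop (𝓝 1) := by
      rw [hder]; simpa using hm1.const_sub 1
    refine ⟨fun x => x - m x, contDiff_id.sub hm, ?_, hd, ?_, ?_⟩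
    · have := hKg.sub hmg
      simp only [sub_zero] at this
      refine this.congr fun x => ?_
      ring
    · intro n hn
      have e : iteratedDeriv n (fun x => x - m x) = fun x => - iteratedDeriv n m x := by
        ext x
        rw [iteratedDeriv_fun_sub contDiffAt_fun_id (hm.contDiffAt.of_le (by exact_mod_cast le_top)),
          iteratedDeriv_fun_id]
        have h0 : n ≠ 0 := by omega
        have h1 : n ≠ 1 := by omega
        simp [h0, h1]
      rw [e]
      simpa using (hmn n hn).neg
    · filter_upwards [hd.eventually (lt_mem_nhds one_pos)] with x hx
      refine ⟨hx, ?_⟩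
      rw [hder]
      have := hm0 x
      simp only
      linarith

lemma aux_Phi (ν : Measure ℝ) (β : ℝ) (hβ : 0 ≤ β)
    (hν0 : ν (Iic 0) = 0)
    (hνint : ∫⁻ u, ENNReal.ofReal (min 1 u) ∂ν < ⊤)
    (Φ : ℝ → ℝ)
    (hΦ : ∀ q, 0 ≤ q → Φ q = β * q + ∫ u, (1 - Real.exp (-q * u)) ∂ν) :
    ∀ q r, 0 ≤ q → q ≤ r → 0 ≤ Φ q ∧ Φ q ≤ Φ r := by
  have hpos : ∀ᵐ u ∂ν, 0 < u := by
    rw [ae_iff]; simp only [not_lt]; exact hν0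
  have hmin : Integrable (fun u : ℝ => min 1 u) ν := by
    refine ⟨(measurable_const.min measurable_id).aestronglyMeasurable, ?_⟩
    rw [hasFiniteIntegral_iff_ofReal]
    · exact hνint
    · filter_upwards [hpos] with u hu
      exact le_min zero_le_one hu.le
  have hI : ∀ q, 0 ≤ q → Integrable (fun u => 1 - Real.exp (-q * u)) ν := by
    intro q hq
    refine (hmin.const_mul (1 + q)).mono' (by fun_prop) ?_
    filter_upwards [hpos] with u hu
    have hqu : 0 ≤ q * u := mul_nonneg hq hu.le
    have h1 : exp (-q * u) ≤ 1 := exp_le_one_iff.2 (by linarith)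
    have h2 := add_one_le_exp (-q * u)
    have h3 := exp_pos (-q * u)
    rw [Real.norm_eq_abs, abs_of_nonneg (by linarith)]
    rcases le_total 1 u with h | h
    · rw [min_eq_left h]; linarith
    · rw [min_eq_right h]; nlinarith
  intro q r hq hqr
  have hr := hq.trans hqr
  rw [hΦ q hq, hΦ r hr]
  constructor
  · refine add_nonneg (mul_nonneg hβ hq) (integral_nonneg_of_ae ?_)
    filter_upwards [hpos] with u hu
    have hqu : 0 ≤ q * u := mul_nonneg hq hu.le
    have h1 : exp (-q * u) ≤ 1 := exp_le_one_iff.2 (by linarith)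
    simpa using h1
  · refine add_le_add (mul_le_mul_of_nonneg_left hqr hβ) (integral_mono_ae (hI q hq) (hI r hr) ?_)
    filter_upwards [hpos] with u hu
    have : exp (-r * u) ≤ exp (-q * u) := exp_le_exp.2 (by nlinarith)
    linarith

/-- existence of a smooth equivalent function φ for the Laplace
exponent Φ of a Lévy measure satisfying Assumption (H). -/
theorem stmt_0
    (ν : Measure ℝ) (β : ℝ) (hβ : 0 ≤ β)
    (hν0 : ν (Iic 0) = 0)
    (hνint : ∫⁻ u, ENNReal.ofReal (min 1 u) ∂ν < ⊤)
    (Φ : ℝ → ℝ)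
    (hΦ : ∀ q, 0 ≤ q → Φ q = β * q + ∫ u, (1 - Real.exp (-q * u)) ∂ν)
    (δ : ℝ) (hδ0 : 0 ≤ δ) (hδ1 : δ ≤ 1)
    (hRV : ∀ l > (0:ℝ), Tendsto (fun x => ((l * x) * Φ (Real.exp (-(l * x)))) /
      (x * Φ (Real.exp (-x)))) atTop (𝓝 (l ^ (1 - δ))))
    (hEq : ∃ H : ℝ → ℝ, Monotone H ∧
      Tendsto (fun x => (x * Φ (Real.exp (-x))) / H x) atTop (𝓝 1)) :
    ∃ φ : ℝ → ℝ,
      (∀ x > (0:ℝ), 0 < φ x) ∧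
      Tendsto (fun y => φ (1 / y) / Φ (1 / y)) atTop (𝓝 1) ∧
      (ContDiff ℝ (⊤ : ℕ∞) (fun x => Real.log (1 / φ (Real.exp (-(Real.exp x))))) ∧
        Tendsto (deriv (fun x => Real.log (1 / φ (Real.exp (-(Real.exp x))))))
          atTop (𝓝 δ) ∧
        ∀ n : ℕ, 2 ≤ n →
          Tendsto (iteratedDeriv n (fun x => Real.log (1 / φ (Real.exp (-(Real.exp x))))))
            atTop (𝓝 0)) ∧
      StrictMonoOn φ (Ioi 0) ∧
      MonotoneOn (fun x => x * φ (Real.exp (-x))) (Ioi 0) := by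
  have hP := aux_Phi ν β hβ hν0 hνint Φ hΦ
  have hpos : ∀ q, 0 < q → 0 < Φ q := by
    intro q hq
    have h2 := (hRV 2 two_pos).eventually (lt_mem_nhds (rpow_pos_of_pos two_pos _))
    have h3 : ∀ᶠ x in atTop, exp (-x) < q :=
      tendsto_exp_neg_atTop_nhds_zero.eventually (gt_mem_nhds hq)
    obtain ⟨x, hx2, hx3⟩ := (h2.and h3).exists
    have hx := hP (exp (-x)) q (exp_pos _).le hx3.le
    rcases hx.1.lt_or_eq with h | h
    · exact h.trans_le hx.2
    · rw [← h] at hx2; simp at hx2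
  set g : ℝ → ℝ := fun x => - Real.log (Φ (exp (-exp x))) with hgdef
  have hg : Monotone g := by
    intro x y hxy
    refine neg_le_neg (log_le_log (hpos _ (exp_pos _)) (hP _ _ (exp_pos _).le ?_).2)
    exact exp_le_exp.2 (neg_le_neg (exp_le_exp.2 hxy))
  have hlim : ∀ t, Tendsto (fun x => g (x + t) - g x) atTop (𝓝 (δ * t)) := by
    intro t
    have h1 := (hRV (exp t) (exp_pos t)).comp tendsto_exp_atTop
    have h2 := (h1.log (rpow_pos_of_pos (exp_pos t) _).ne').const_sub t
    rw [log_rpow (exp_pos t), log_exp] at h2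
    have e : t - (1 - δ) * t = δ * t := by ring
    rw [e] at h2
    refine h2.congr fun x => ?_
    have p1 := hpos _ (exp_pos (-(exp t * exp x)))
    have p2 := hpos _ (exp_pos (-(exp x)))
    simp only [Function.comp, hgdef]
    rw [log_div (by positivity) (by positivity), log_mul (by positivity) p1.ne',
      log_mul (by positivity) p2.ne', log_mul (by positivity) (by positivity), log_exp, log_exp,
      exp_add x t, mul_comm (exp x) (exp t)]
    ring
  obtain ⟨H, hHm, hH⟩ := hEq
  obtain ⟨Y, hY⟩ : ∃ Y, ∀ y ≥ Y, 0 < H y := by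
    have := (hH.eventually (lt_mem_nhds one_pos)).and (eventually_gt_atTop 0)
    obtain ⟨Y, hY⟩ := eventually_atTop.1 this
    refine ⟨Y, fun y hy => ?_⟩
    obtain ⟨h1, h2⟩ := hY y hy
    have p := hpos _ (exp_pos (-y))
    exact (div_pos_iff_of_pos_left (by positivity)).1 h1
  set K : ℝ → ℝ := fun x => Real.log (H (max (exp x) Y)) with hKdef
  have hK : Monotone K := by
    intro x y hxy
    refine log_le_log (hY _ (le_max_right _ _)) (hHm ?_)
    exact max_le_max (exp_le_exp.2 hxy) le_rfl
  have hKg : Tendsto (fun x => x - g x - K x) atTop (𝓝 0) := by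
    have h1 := (hH.comp tendsto_exp_atTop).log one_ne_zero
    rw [log_one] at h1
    refine h1.congr' ?_
    filter_upwards [tendsto_exp_atTop.eventually (eventually_ge_atTop Y)] with x hx
    have p2 := hpos _ (exp_pos (-(exp x)))
    have p3 := hY _ hx
    simp only [Function.comp, hgdef, hKdef]
    rw [max_eq_left hx, log_div (by positivity) p3.ne', log_mul (by positivity) p2.ne', log_exp]
    ring
  obtain ⟨h0, hs0, hg0, hd0, hn0, hb0⟩ := aux_core g K hg hK δ hδ0 hδ1 hlim hKg
  obtain ⟨h, hs, ⟨X, hX⟩, hb, c, hc⟩ := aux_glue h0 hs0 hb0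
  have hsm : StrictMono h := strictMono_of_deriv_pos fun x => (hb x).1
  have hm1 : Monotone (fun x => x - h x) := by
    have hdf := (contDiff_infty_iff_deriv.1 hs).1
    refine monotone_of_deriv_nonneg (differentiable_id.sub hdf) fun x => ?_
    have := ((hasDerivAt_id' x).fun_sub (hdf x).hasDerivAt).deriv
    rw [this]
    linarith [(hb x).2]
  have hev : ∀ n, iteratedDeriv n h0 =ᶠ[atTop] iteratedDeriv n h := by
    intro n
    filter_upwards [eventually_gt_atTop X] with x hx
    refine (EventuallyEq.iteratedDeriv_eq n ?_).symm
    filter_upwards [lt_mem_nhds hx] with y hy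
    exact hX y hy.le
  set φ : ℝ → ℝ := fun q => if q < 1 then exp (-h (Real.log (-Real.log q))) else exp (-c) * q
    with hφdef
  have hφexp : ∀ x, 0 < x → φ (exp (-x)) = exp (-h (Real.log x)) := by
    intro x hx
    have : exp (-x) < 1 := (by rw [← exp_zero]; exact exp_lt_exp.2 (by linarith))
    simp only [hφdef, this, if_true, log_exp, neg_neg]
  have hφee : (fun x => Real.log (1 / φ (exp (-(exp x))))) = h := by
    ext x
    rw [hφexp _ (exp_pos x), log_exp, one_div, log_inv, log_exp, neg_neg]
  refine ⟨φ, ?_, ?_, ?_, ?_, ?_⟩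
  · intro x hx
    simp only [hφdef]
    split_ifs <;> positivity
  · have hl : Tendsto (fun y : ℝ => Real.log (Real.log y)) atTop atTop :=
      tendsto_log_atTop.comp tendsto_log_atTop
    have h1 : Tendsto (fun x => exp (-(h x - g x))) atTop (𝓝 1) := by
      have : Tendsto (fun x => h x - g x) atTop (𝓝 0) := by
        refine hg0.congr' ?_
        filter_upwards [eventually_ge_atTop X] with x hx
        rw [hX x hx]
      have := (continuous_exp.tendsto _).comp this.neg
      simpa [Function.comp_def] using this
    refine (h1.comp hl).congr' ?_
    filter_upwards [eventually_gt_atTop 1] with y hy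
    have hly := log_pos hy
    have e : 1 / y = exp (-Real.log y) := by rw [exp_neg, exp_log (by linarith), one_div]
    rw [e, hφexp _ hly]
    simp only [Function.comp, hgdef]
    rw [exp_log hly, sub_neg_eq_add, neg_add, exp_add, exp_neg (Real.log _),
      exp_log (hpos _ (exp_pos _)), div_eq_mul_inv]
  · rw [hφee]
    refine ⟨hs, ?_, fun n hn => (hn0 n hn).congr' (hev n)⟩
    have := hev 1
    rw [iteratedDeriv_one, iteratedDeriv_one] at this
    exact hd0.congr' this
  · intro a ha b hb' hab
    rw [mem_Ioi] at ha hb'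
    simp only [hφdef]
    by_cases hb1 : b < 1
    · have ha1 : a < 1 := hab.trans hb1
      rw [if_pos ha1, if_pos hb1]
      refine exp_lt_exp.2 (neg_lt_neg (hsm ?_))
      have := log_neg hb' hb1
      exact log_lt_log (by linarith) (neg_lt_neg (log_lt_log ha hab))
    · rw [if_neg hb1]
      push Not at hb1
      split_ifs with ha1
      · have h1 : exp (-h (Real.log (-Real.log a))) < exp (-c) := exp_lt_exp.2 (neg_lt_neg (hc _))
        have := exp_pos (-c)
        nlinarith
      · exact mul_lt_mul_of_pos_left hab (exp_pos _)
  · intro a ha b hb' hab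
    rw [mem_Ioi] at ha hb'
    simp only
    have e : ∀ x, 0 < x → x * φ (exp (-x)) = exp (Real.log x - h (Real.log x)) := by
      intro x hx
      rw [hφexp x hx, sub_eq_add_neg, exp_add, exp_log hx]
    rw [e a ha, e b hb']
    exact exp_le_exp.2 (hm1 (log_le_log ha hab))
end

section
/- Let ν be a Lévy measure with tail ν̄ and Laplace exponent Φ(q) = βq + ∫₀^∞(1−e^{−qu})ν(du), β ≥ 0, satisfying Assumption (H). Let φ:(0,∞)→(0,∞) be a strictly increasing bijection of (0,∞) onto (0,∞) such that φ(1/y)/Φ(1/y) → 1 as y → ∞ and such that x ↦ xφ(e^{−x}) is nondecreasing. For t > 0 define g_t^{-1}(x) := 1/φ^{-1}(1/(xt)) for x > 0 and g_t^{-1}(0) := 0. Then for every c₀ > 0, sup over all x ≥ 0 and v ≥ x + c₀ of |t·ν̄(g_t^{-1}(v) − g_t^{-1}(x)) − 1/v| tends to 0 as t → ∞. -/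
open Real MeasureTheory Filter Set Topology

lemma aux_int_min (ν : Measure ℝ) (hν0 : ν (Iic 0) = 0)
    (hνint : ∫⁻ u, ENNReal.ofReal (min 1 u) ∂ν < ⊤) :
    Integrable (fun u : ℝ => min 1 u) ν := by
  refine ⟨by fun_prop, ?_⟩
  rw [hasFiniteIntegral_iff_ofReal]
  · exact hνint
  · have : ∀ᵐ u ∂ν, u ∉ Iic (0:ℝ) := measure_eq_zero_iff_ae_notMem.mp hν0
    filter_upwards [this] with u hu
    simp only [mem_Iic, not_le] at hu
    simp [hu.le]

lemma aux_pos (ν : Measure ℝ) (hν0 : ν (Iic 0) = 0) : ∀ᵐ u ∂ν, 0 < u := by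
  have : ∀ᵐ u ∂ν, u ∉ Iic (0:ℝ) := measure_eq_zero_iff_ae_notMem.mp hν0
  filter_upwards [this] with u hu
  simpa using hu

lemma aux_int (ν : Measure ℝ) (hν0 : ν (Iic 0) = 0)
    (hνint : ∫⁻ u, ENNReal.ofReal (min 1 u) ∂ν < ⊤) (q : ℝ) (hq : 0 ≤ q) :
    Integrable (fun u : ℝ => 1 - Real.exp (-q * u)) ν := by
  refine ((aux_int_min ν hν0 hνint).const_mul (max 1 q)).mono' (by fun_prop) ?_
  filter_upwards [aux_pos ν hν0] with u hu
  have h1 : Real.exp (-q * u) ≤ 1 := by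
    rw [Real.exp_le_one_iff]; nlinarith
  have h2 := Real.add_one_le_exp (-q * u)
  have h3 := Real.exp_pos (-q * u)
  rw [Real.norm_eq_abs, abs_of_nonneg (by linarith)]
  have hm1 := le_max_left 1 q
  have hm2 := le_max_right 1 q
  rcases le_total 1 u with h | h
  · rw [min_eq_left h]; linarith
  · rw [min_eq_right h]; nlinarith

lemma aux_fin (ν : Measure ℝ) (hν0 : ν (Iic 0) = 0)
    (hνint : ∫⁻ u, ENNReal.ofReal (min 1 u) ∂ν < ⊤) (w : ℝ) (hw : 0 < w) :
    ν (Ioi w) < ⊤ := by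
  have h := (aux_int_min ν hν0 hνint).measure_ge_lt_top (ε := min 1 w) (by positivity)
  refine lt_of_le_of_lt (measure_mono ?_) h
  intro u hu
  have hu' : w < u := hu
  have hmin : min 1 w ≤ min 1 u := min_le_min le_rfl hu'.le
  exact hmin

lemma aux_upper (ν : Measure ℝ) (β : ℝ) (hβ : 0 ≤ β) (hν0 : ν (Iic 0) = 0)
    (hνint : ∫⁻ u, ENNReal.ofReal (min 1 u) ∂ν < ⊤) (w K : ℝ) (hw : 0 < w) (hK : 0 < K) :
    (1 - Real.exp (-K)) * (ν (Ioi w)).toReal ≤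
      β * (K / w) + ∫ u, (1 - Real.exp (-(K / w) * u)) ∂ν := by
  have hf := aux_fin ν hν0 hνint w hw
  have hq : 0 ≤ K / w := by positivity
  have h0 : 0 ≤ β * (K / w) := by positivity
  have hi : Integrable ((Ioi w).indicator (fun _ : ℝ => 1 - Real.exp (-K))) ν :=
    (integrable_indicator_iff measurableSet_Ioi).2 (integrableOn_const hf.ne)
  have h1 : ∫ u, (Ioi w).indicator (fun _ : ℝ => 1 - Real.exp (-K)) u ∂ν
      = (1 - Real.exp (-K)) * (ν (Ioi w)).toReal := by
    rw [integral_indicator measurableSet_Ioi, setIntegral_const, smul_eq_mul, mul_comm]; rfl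
  rw [← h1]
  refine le_trans (integral_mono_ae hi (aux_int ν hν0 hνint _ hq) ?_) (by linarith)
  filter_upwards [aux_pos ν hν0] with u hu
  by_cases h : u ∈ Ioi w
  · rw [indicator_of_mem h]
    have : K ≤ K / w * u := by
      rw [div_mul_eq_mul_div, le_div_iff₀ hw]; exact mul_le_mul_of_nonneg_left (le_of_lt h) hK.le
    have := Real.exp_le_exp.2 (show -(K / w) * u ≤ -K by linarith)
    linarith
  · rw [indicator_of_notMem h]
    have : Real.exp (-(K / w) * u) ≤ 1 := by
      rw [Real.exp_le_one_iff]; nlinarith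
    linarith

lemma aux_lower (ν : Measure ℝ) (β : ℝ) (hβ : 0 ≤ β) (hν0 : ν (Iic 0) = 0)
    (hνint : ∫⁻ u, ENNReal.ofReal (min 1 u) ∂ν < ⊤) (w δ : ℝ) (hw : 0 < w) (hδ : 0 < δ) :
    β * (δ / w) + ∫ u, (1 - Real.exp (-(δ / w) * u)) ∂ν ≤ (ν (Ioi w)).toReal +
      2 * δ * (β * (1 / w) + ∫ u, (1 - Real.exp (-(1 / w) * u)) ∂ν) := by
  have hf := aux_fin ν hν0 hνint w hw
  have hi : Integrable ((Ioi w).indicator (fun _ : ℝ => (1:ℝ))) ν :=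
    (integrable_indicator_iff measurableSet_Ioi).2 (integrableOn_const hf.ne)
  have h1 : ∫ u, (Ioi w).indicator (fun _ : ℝ => (1:ℝ)) u ∂ν = (ν (Ioi w)).toReal := by
    rw [integral_indicator measurableSet_Ioi, setIntegral_const, smul_eq_mul, mul_one]; rfl
  have i1 := aux_int ν hν0 hνint (δ / w) (by positivity)
  have i2 := (aux_int ν hν0 hνint (1 / w) (by positivity)).const_mul (2 * δ)
  have key : ∫ u, (1 - Real.exp (-(δ / w) * u)) ∂ν ≤
      ∫ u, ((Ioi w).indicator (fun _ : ℝ => (1:ℝ)) u +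
        2 * δ * (1 - Real.exp (-(1 / w) * u))) ∂ν := by
    refine integral_mono_ae i1 (hi.add i2) ?_
    filter_upwards [aux_pos ν hν0] with u hu
    obtain ⟨s, hs⟩ : ∃ s, s = u / w := ⟨_, rfl⟩
    have hs0 : 0 < s := by rw [hs]; positivity
    have e1 : -(δ / w) * u = -(δ * s) := by rw [hs]; ring
    have e2 : -(1 / w) * u = -s := by rw [hs]; ring
    rw [e1, e2]
    have hes : Real.exp (-s) ≤ 1 := by rw [Real.exp_le_one_iff]; linarith
    by_cases h : u ∈ Ioi w
    · rw [indicator_of_mem h]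
      have := Real.exp_pos (-(δ * s))
      have : 0 ≤ 2 * δ * (1 - Real.exp (-s)) := by
        apply mul_nonneg <;> linarith
      linarith
    · rw [indicator_of_notMem h]
      have hs1 : s ≤ 1 := by
        rw [hs, div_le_one hw]; simpa using h
      have a1 := Real.add_one_le_exp (-(δ * s))
      have a2 : s ≤ 2 * (1 - Real.exp (-s)) := by
        have b1 := Real.add_one_le_exp s
        have b2 : Real.exp (-s) * Real.exp s = 1 := by rw [← Real.exp_add]; simp
        have b3 := Real.exp_pos (-s)
        have b4 : Real.exp (-s) * (s + 1) ≤ 1 := by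
          exact (mul_le_mul_of_nonneg_left b1 b3.le).trans b2.le
        nlinarith
      have := mul_le_mul_of_nonneg_left a2 hδ.le
      linarith
  rw [integral_add hi i2, h1, integral_const_mul] at key
  have : 0 ≤ β * (δ / w) := by positivity
  have e : β * (δ / w) = δ * (β * (1 / w)) := by ring
  have : 0 ≤ δ * (β * (1 / w)) := by positivity
  linarith

lemma aux_slow (φ : ℝ → ℝ)
    (hφpos : ∀ x > (0:ℝ), 0 < φ x)
    (hφmono : StrictMonoOn φ (Ioi 0))
    (hφnd : MonotoneOn (fun x => x * φ (Real.exp (-x))) (Ioi 0)) (l : ℝ) (hl : 0 < l) :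
    Tendsto (fun u => φ (l / u) / φ (1 / u)) atTop (𝓝 1) := by
  have hlim : Tendsto (fun u : ℝ => Real.log u / (Real.log u - Real.log l)) atTop (𝓝 1) := by
    have h1 : Tendsto (fun x : ℝ => 1 + Real.log l / (x - Real.log l)) atTop (𝓝 (1 + 0)) :=
      tendsto_const_nhds.add (tendsto_const_nhds.div_atTop
        (tendsto_atTop_add_const_right _ _ tendsto_id))
    rw [add_zero] at h1
    refine (h1.comp Real.tendsto_log_atTop).congr' ?_
    filter_upwards [Real.tendsto_log_atTop.eventually_gt_atTop (Real.log l)] with u hu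
    have : Real.log u - Real.log l ≠ 0 := by linarith
    simp only [Function.comp]
    field_simp
    ring
  have hk : ∀ᶠ u : ℝ in atTop, 0 < u ∧ 0 < Real.log u ∧ 0 < Real.log u - Real.log l := by
    filter_upwards [Real.tendsto_log_atTop.eventually_gt_atTop (Real.log l),
      Real.tendsto_log_atTop.eventually_gt_atTop 0, eventually_gt_atTop 0] with u h1 h2 h3
    exact ⟨h3, h2, by linarith⟩
  have e1 : ∀ u : ℝ, 0 < u → Real.exp (-(Real.log u - Real.log l)) = l / u := by
    intro u hu
    rw [neg_sub, Real.exp_sub, Real.exp_log hl, Real.exp_log hu]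
  have e2 : ∀ u : ℝ, 0 < u → Real.exp (-Real.log u) = 1 / u := by
    intro u hu
    rw [Real.exp_neg, Real.exp_log hu, one_div]
  rcases le_total 1 l with h | h
  · refine tendsto_of_tendsto_of_tendsto_of_le_of_le' tendsto_const_nhds hlim ?_ ?_
    · filter_upwards [hk] with u ⟨hu, h1, h2⟩
      rw [one_le_div (hφpos _ (by positivity))]
      exact hφmono.monotoneOn (mem_Ioi.2 (by positivity)) (mem_Ioi.2 (by positivity)) (by gcongr)
    · filter_upwards [hk] with u ⟨hu, h1, h2⟩
      have := hφnd (mem_Ioi.2 h2) (mem_Ioi.2 h1) (by linarith [Real.log_nonneg h])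
      simp only [e1 u hu, e2 u hu] at this
      rw [div_le_div_iff₀ (hφpos _ (by positivity)) h2]
      linarith
  · refine tendsto_of_tendsto_of_tendsto_of_le_of_le' hlim tendsto_const_nhds ?_ ?_
    · filter_upwards [hk] with u ⟨hu, h1, h2⟩
      have := hφnd (mem_Ioi.2 h1) (mem_Ioi.2 h2) (by linarith [Real.log_nonpos hl.le h])
      simp only [e1 u hu, e2 u hu] at this
      rw [div_le_div_iff₀ h2 (hφpos _ (by positivity))]
      linarith
    · filter_upwards [hk] with u ⟨hu, h1, h2⟩
      rw [div_le_one (hφpos _ (by positivity))]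
      exact hφmono.monotoneOn (mem_Ioi.2 (by positivity)) (mem_Ioi.2 (by positivity)) (by gcongr)

lemma aux_Phi_s2 (φ Φ : ℝ → ℝ)
    (hφpos : ∀ x > (0:ℝ), 0 < φ x)
    (hφmono : StrictMonoOn φ (Ioi 0))
    (hφequiv : Tendsto (fun y => φ (1 / y) / Φ (1 / y)) atTop (𝓝 1))
    (hφnd : MonotoneOn (fun x => x * φ (Real.exp (-x))) (Ioi 0)) (l : ℝ) (hl : 0 < l) :
    Tendsto (fun u => Φ (l / u) / φ (1 / u)) atTop (𝓝 1) := by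
  have h1 := aux_slow φ hφpos hφmono hφnd l hl
  have h2 := (hφequiv.comp (tendsto_id.atTop_div_const hl)).inv₀ one_ne_zero
  have h3 := h2.mul h1
  simp only [inv_one, mul_one] at h3
  refine h3.congr' ?_
  filter_upwards [eventually_gt_atTop 0] with u hu
  have a := hφpos (l / u) (by positivity)
  simp only [Function.comp, id, one_div_div, inv_div]
  field_simp

lemma aux_tail (ν : Measure ℝ) (β : ℝ) (hβ : 0 ≤ β) (hν0 : ν (Iic 0) = 0)
    (hνint : ∫⁻ u, ENNReal.ofReal (min 1 u) ∂ν < ⊤) (Φ φ : ℝ → ℝ)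
    (hΦ : ∀ q, 0 ≤ q → Φ q = β * q + ∫ u, (1 - Real.exp (-q * u)) ∂ν)
    (hφpos : ∀ x > (0:ℝ), 0 < φ x)
    (hφmono : StrictMonoOn φ (Ioi 0))
    (hφequiv : Tendsto (fun y => φ (1 / y) / Φ (1 / y)) atTop (𝓝 1))
    (hφnd : MonotoneOn (fun x => x * φ (Real.exp (-x))) (Ioi 0)) (ε : ℝ) (hε : 0 < ε) :
    ∀ᶠ u in atTop, 0 < u ∧ (1 - ε) * φ (1 / u) ≤ (ν (Ioi u)).toReal ∧
      (ν (Ioi (u / 2))).toReal ≤ (1 + ε) * φ (1 / u) := by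
  have hP := aux_Phi_s2 φ Φ hφpos hφmono hφequiv hφnd
  set η : ℝ := ε / (2 + ε) with hη
  have hη0 : 0 < η := by positivity
  have hη1 : η < 1 := by rw [hη, div_lt_one (by positivity)]; linarith
  set K := -Real.log η with hK
  have hK0 : 0 < K := by rw [hK]; linarith [Real.log_neg hη0 hη1]
  have hKe : Real.exp (-K) = η := by rw [hK, neg_neg, Real.exp_log hη0]
  set δ := min ε 1 / 5 with hδ
  have hδ0 : 0 < δ := by positivity
  have hδ1 : δ ≤ ε / 5 := by rw [hδ]; gcongr; exact min_le_left _ _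
  have hδ2 : δ ≤ 1 / 5 := by rw [hδ]; gcongr; exact min_le_right _ _
  filter_upwards [eventually_gt_atTop 0,
    (hP (2 * K) (by positivity)).eventually_le_const (show 1 < 1 + η by linarith),
    (hP δ hδ0).eventually_const_le (show 1 - δ < 1 by linarith),
    (hP 1 one_pos).eventually_le_const (show 1 < 1 + δ by linarith)] with u hu h1 h2 h3
  have hp := hφpos (1 / u) (by positivity)
  rw [div_le_iff₀ hp] at h1 h3
  rw [le_div_iff₀ hp] at h2
  refine ⟨hu, ?_, ?_⟩
  · have := aux_lower ν β hβ hν0 hνint u δ hu hδ0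
    rw [← hΦ _ (by positivity), ← hΦ _ (by positivity)] at this
    have h4 : 2 * δ * Φ (1 / u) ≤ 2 * δ * ((1 + δ) * φ (1 / u)) := by gcongr
    have h5 : (1 - ε) * φ (1 / u) ≤ (1 - δ - 2 * δ * (1 + δ)) * φ (1 / u) := by
      refine mul_le_mul_of_nonneg_right ?_ hp.le
      nlinarith
    nlinarith
  · have := aux_upper ν β hβ hν0 hνint (u / 2) K (by positivity) hK0
    rw [← hΦ _ (by positivity), hKe, show K / (u / 2) = 2 * K / u by field_simp] at this
    have e : (1 + η) = (1 + ε) * (1 - η) := by rw [hη]; field_simp; ring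
    rw [e] at h1
    have h6 : (1 - η) * (ν (Ioi (u / 2))).toReal ≤ (1 - η) * ((1 + ε) * φ (1 / u)) := by
      linarith
    exact le_of_mul_le_mul_left h6 (by linarith)

/-- uniform convergence of `t ν̄(g_t⁻¹(v) − g_t⁻¹(x))` to `1/v`
uniformly over `x ≥ 0`, `v ≥ x + c₀`. -/
theorem stmt_2
    (ν : Measure ℝ) (β : ℝ) (hβ : 0 ≤ β)
    (hν0 : ν (Iic 0) = 0)
    (hνint : ∫⁻ u, ENNReal.ofReal (min 1 u) ∂ν < ⊤)
    (Φ : ℝ → ℝ)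
    (hΦ : ∀ q, 0 ≤ q → Φ q = β * q + ∫ u, (1 - Real.exp (-q * u)) ∂ν)
    -- Assumption (H)
    (hH : ∃ ρ : ℝ,
      (∀ l > (0:ℝ), Tendsto (fun x => ((l * x) * Φ (Real.exp (-(l * x)))) /
        (x * Φ (Real.exp (-x)))) atTop (𝓝 (l ^ ρ))) ∧
      ∃ H : ℝ → ℝ, Monotone H ∧
        Tendsto (fun x => (x * Φ (Real.exp (-x))) / H x) atTop (𝓝 1))
    -- φ : strictly increasing bijection of (0,∞) onto (0,∞), with inverse φinv
    (φ φinv : ℝ → ℝ)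
    (hφpos : ∀ x > (0:ℝ), 0 < φ x)
    (hφmono : StrictMonoOn φ (Ioi 0))
    (hφsurj : φ '' (Ioi 0) = Ioi 0)
    (hφinv : ∀ x > (0:ℝ), φinv (φ x) = x ∧ φ (φinv x) = x ∧ 0 < φinv x)
    (hφequiv : Tendsto (fun y => φ (1 / y) / Φ (1 / y)) atTop (𝓝 1))
    (hφnd : MonotoneOn (fun x => x * φ (Real.exp (-x))) (Ioi 0))
    -- the renormalisation inverse g_t⁻¹
    (ginv : ℝ → ℝ → ℝ)
    (hginv : ∀ t x, ginv t x = if x = 0 then 0 else 1 / φinv (1 / (x * t))) :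
    ∀ c₀ > (0:ℝ), ∀ ε > (0:ℝ), ∃ T : ℝ, ∀ t ≥ T, ∀ x ≥ (0:ℝ), ∀ v ≥ x + c₀,
      |t * (ν (Ioi (ginv t v - ginv t x))).toReal - 1 / v| < ε := by
  intro c₀ hc₀ ε hε
  have hε' : 0 < ε * c₀ / 2 := by positivity
  obtain ⟨U, hU⟩ := eventually_atTop.1
    (aux_tail ν β hβ hν0 hνint Φ φ hΦ hφpos hφmono hφequiv hφnd _ hε')
  obtain ⟨R, hR⟩ : ∃ R : ℝ, R = max U (Real.exp 1) := ⟨_, rfl⟩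
  have hRU : U ≤ R := by rw [hR]; exact le_max_left _ _
  have hRe : Real.exp 1 ≤ R := by rw [hR]; exact le_max_right _ _
  have hR0 : 0 < R := (Real.exp_pos 1).trans_le hRe
  have hφR := hφpos (1 / R) (by positivity)
  have hφ1 := hφpos (Real.exp (-1)) (Real.exp_pos _)
  refine ⟨max (1 / (c₀ * φ (1 / R))) (1 / (c₀ * φ (Real.exp (-1)))), ?_⟩
  intro t ht x hx v hv
  have ht1 : 1 / (c₀ * φ (1 / R)) ≤ t := (le_max_left _ _).trans ht
  have ht2 : 1 / (c₀ * φ (Real.exp (-1))) ≤ t := (le_max_right _ _).trans ht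
  have ht0 : 0 < t := lt_of_lt_of_le (by positivity) ht1
  have hv0 : 0 < v := by linarith
  have hY : ∀ z, 0 < z → 0 < ginv t z ∧ φ (1 / ginv t z) = 1 / (z * t) := by
    intro z hz
    obtain ⟨-, h2, h3⟩ := hφinv (1 / (z * t)) (by positivity)
    rw [hginv, if_neg hz.ne']
    refine ⟨by positivity, ?_⟩
    rw [one_div_one_div, h2]
  obtain ⟨hyv, hφv⟩ := hY v hv0
  have hyR : R ≤ ginv t v := by
    by_contra hlt
    push Not at hlt
    have h1 : φ (1 / R) < φ (1 / ginv t v) :=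
      hφmono (mem_Ioi.2 (by positivity)) (mem_Ioi.2 (by positivity)) (by gcongr)
    rw [hφv, lt_div_iff₀ (by positivity)] at h1
    rw [div_le_iff₀ (by positivity)] at ht1
    have h2 : φ (1 / R) * (c₀ * t) ≤ φ (1 / R) * (v * t) := by gcongr; linarith
    linarith
  obtain ⟨a, ha⟩ : ∃ a, a = Real.log (ginv t v) := ⟨_, rfl⟩
  have hea : Real.exp a = ginv t v := by rw [ha, Real.exp_log hyv]
  have ha1 : 1 ≤ a := by
    rw [← Real.exp_le_exp, hea]; linarith
  have hφa : φ (Real.exp (-a)) = 1 / (v * t) := by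
    rw [Real.exp_neg, hea, ← one_div, hφv]
  have hac : v ≤ a * c₀ := by
    have h1 := hφnd (mem_Ioi.2 one_pos) (mem_Ioi.2 (by linarith)) ha1
    simp only [hφa, one_mul] at h1
    rw [mul_one_div, le_div_iff₀ (by positivity)] at h1
    rw [div_le_iff₀ (by positivity)] at ht2
    have h3 : v * 1 ≤ v * (t * (c₀ * φ (Real.exp (-1)))) := by gcongr
    nlinarith
  have hyx : 0 ≤ ginv t x ∧ ginv t x ≤ ginv t v / 2 := by
    rcases hx.eq_or_lt with h | hx0
    · rw [hginv t x, if_pos h.symm]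
      exact ⟨le_rfl, by positivity⟩
    · obtain ⟨hyx, hφx⟩ := hY x hx0
      refine ⟨hyx.le, ?_⟩
      obtain ⟨b, hb⟩ : ∃ b, b = Real.log (ginv t x) := ⟨_, rfl⟩
      have heb : Real.exp b = ginv t x := by rw [hb, Real.exp_log hyx]
      have hφb : φ (Real.exp (-b)) = 1 / (x * t) := by
        rw [Real.exp_neg, heb, ← one_div, hφx]
      have hab : b + 1 ≤ a := by
        rcases le_or_gt b 0 with hb0 | hb0
        · linarith
        · have hba : b ≤ a := by
            by_contra hlt
            push Not at hlt
            have h1 : φ (Real.exp (-b)) < φ (Real.exp (-a)) :=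
              hφmono (mem_Ioi.2 (Real.exp_pos _)) (mem_Ioi.2 (Real.exp_pos _))
                (Real.exp_lt_exp.2 (by linarith))
            rw [hφa, hφb, div_lt_div_iff₀ (by positivity) (by positivity)] at h1
            nlinarith
          have h1 := hφnd (mem_Ioi.2 hb0) (mem_Ioi.2 (by linarith)) hba
          simp only [hφa, hφb] at h1
          rw [mul_one_div, mul_one_div, div_le_div_iff₀ (by positivity) (by positivity)] at h1
          have h2 : b * v ≤ a * x := by
            have : (b * v) * t ≤ (a * x) * t := by linarith
            exact le_of_mul_le_mul_right this ht0
          have h3 : a * x ≤ a * (v - c₀) := by gcongr; linarith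
          have h4 : (b + 1) * v ≤ a * v := by linarith
          exact le_of_mul_le_mul_right h4 hv0
      have h5 : Real.exp b * 2 ≤ Real.exp a := by
        calc Real.exp b * 2 ≤ Real.exp b * Real.exp 1 := by
              gcongr; linarith [Real.add_one_le_exp 1]
          _ = Real.exp (b + 1) := (Real.exp_add _ _).symm
          _ ≤ Real.exp a := Real.exp_le_exp.2 hab
      rw [hea, heb] at h5
      linarith
  obtain ⟨hyx0, hyx2⟩ := hyx
  obtain ⟨-, hlo, hhi⟩ := hU (ginv t v) (hRU.trans hyR)
  rw [hφv] at hlo hhi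
  have m1 : (ν (Ioi (ginv t v))).toReal ≤ (ν (Ioi (ginv t v - ginv t x))).toReal :=
    ENNReal.toReal_mono (aux_fin ν hν0 hνint _ (by linarith)).ne
      (measure_mono (Ioi_subset_Ioi (by linarith)))
  have m2 : (ν (Ioi (ginv t v - ginv t x))).toReal ≤ (ν (Ioi (ginv t v / 2))).toReal :=
    ENNReal.toReal_mono (aux_fin ν hν0 hνint _ (by linarith)).ne
      (measure_mono (Ioi_subset_Ioi (by linarith)))
  have n1 := mul_le_mul_of_nonneg_left (hlo.trans m1) ht0.le
  have n2 := mul_le_mul_of_nonneg_left (m2.trans hhi) ht0.le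
  have e : t * (1 / (v * t)) = 1 / v := by field_simp
  have e1 : t * ((1 - ε * c₀ / 2) * (1 / (v * t))) = 1 / v - ε / 2 * (c₀ / v) := by
    field_simp
  have e2 : t * ((1 + ε * c₀ / 2) * (1 / (v * t))) = 1 / v + ε / 2 * (c₀ / v) := by
    field_simp
  rw [e1] at n1
  rw [e2] at n2
  have hc : ε / 2 * (c₀ / v) ≤ ε / 2 * 1 := by
    gcongr
    rw [div_le_one hv0]; linarith
  rw [abs_lt]
  constructor <;> linarith
end

section
/- Let ν be a Lévy measure with tail ν̄ and Laplace exponent Φ(q) = βq + ∫₀^∞(1−e^{−qu})ν(du), β ≥ 0. If Φ is slowly varying at 0, then (∫₀^z ν̄(u) du) / (z·Φ(1/z)) → 1 as z → ∞. -/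
open Real MeasureTheory Filter Set Topology

/-- Karamata Tauberian step: if Φ is slowly varying at 0 then
`∫₀^z ν̄(u) du ∼ z Φ(1/z)` as `z → ∞`. -/
theorem stmt_6
    (ν : Measure ℝ) (β : ℝ) (hβ : 0 ≤ β)
    (hν0 : ν (Iic 0) = 0)
    (hνint : ∫⁻ u, ENNReal.ofReal (min 1 u) ∂ν < ⊤)
    (Φ : ℝ → ℝ)
    (hΦ : ∀ q, 0 ≤ q → Φ q = β * q + ∫ u, (1 - Real.exp (-q * u)) ∂ν)
    (hSV : ∀ l > (0:ℝ), Tendsto (fun x => Φ (l * x) / Φ x) (𝓝[>] 0) (𝓝 1)) :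
    Tendsto (fun z => (∫ u in Ioc (0:ℝ) z, (ν (Ioi u)).toReal) / (z * Φ (1 / z)))
      atTop (𝓝 1) := by
  have hpos : ∀ᵐ u ∂ν, 0 < u := by
    rw [ae_iff]
    convert hν0 using 2
    ext u; simp
  have hint1 : Integrable (fun u : ℝ => min 1 u) ν := by
    refine ⟨by fun_prop, ?_⟩
    rw [hasFiniteIntegral_iff_ofReal]
    · exact hνint
    · filter_upwards [hpos] with u hu
      exact le_min zero_le_one hu.le
  have hintmin : ∀ q > (0:ℝ), Integrable (fun u : ℝ => min (q * u) 1) ν := by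
    intro q hq
    refine (hint1.const_mul (max q 1)).mono' (by fun_prop) ?_
    filter_upwards [hpos] with u hu
    have h0 : 0 < q * u := by positivity
    rw [Real.norm_of_nonneg (le_min h0.le zero_le_one)]
    rcases le_total 1 u with h | h
    · rw [min_eq_left h, mul_one]
      exact (min_le_right _ _).trans (le_max_right _ _)
    · rw [min_eq_right h]
      exact (min_le_left _ _).trans (mul_le_mul_of_nonneg_right (le_max_left _ _) hu.le)
  have hup : ∀ x : ℝ, 0 ≤ x → 1 - Real.exp (-x) ≤ min x 1 := by
    intro x hx
    refine le_min ?_ ?_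
    · linarith [Real.add_one_le_exp (-x)]
    · linarith [Real.exp_pos (-x)]
  have hintexp : ∀ q > (0:ℝ), Integrable (fun u : ℝ => 1 - Real.exp (-q * u)) ν := by
    intro q hq
    refine (hintmin q hq).mono' (by fun_prop) ?_
    filter_upwards [hpos] with u hu
    have h0 : 0 < q * u := by positivity
    have : Real.exp (-q * u) ≤ 1 := by
      rw [Real.exp_le_one_iff]; linarith
    rw [Real.norm_of_nonneg (by linarith), neg_mul]
    exact hup _ h0.le
  -- lower bound by concavity
  have hlow : ∀ l > (0:ℝ), ∀ x : ℝ, 0 ≤ x →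
      (1 - Real.exp (-l)) * min x 1 ≤ 1 - Real.exp (-(l * x)) := by
    intro l hl x hx
    rcases le_total x 1 with h | h
    · rw [min_eq_left h]
      have := convexOn_exp.2 (mem_univ 0) (mem_univ (-l)) (sub_nonneg.2 h) hx (by ring)
      simp only [smul_eq_mul, mul_zero, zero_add, Real.exp_zero, mul_one] at this
      rw [show x * -l = -(l * x) by ring] at this
      linarith
    · rw [min_eq_right h, mul_one]
      have : Real.exp (-(l * x)) ≤ Real.exp (-l) := Real.exp_le_exp.2 (by nlinarith)
      linarith
  set G : ℝ → ℝ := fun q => ∫ u, min (q * u) 1 ∂ν with hG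
  have hlayer : ∀ z > (0:ℝ), (∫ u in Ioc (0:ℝ) z, (ν (Ioi u)).toReal) = z * G (1 / z) := by
    intro z hz
    have hm : (fun u : ℝ => min u z) = fun u => z * min (1 / z * u) 1 := by
      ext u
      rw [mul_min_of_nonneg _ _ hz.le]
      field_simp
    have hi : Integrable (fun u : ℝ => min u z) ν := by
      rw [hm]; exact (hintmin _ (by positivity)).const_mul z
    have h1 : ∫ u, min u z ∂ν = z * G (1 / z) := by
      rw [hm, integral_const_mul]
    rw [← h1, hi.integral_eq_integral_meas_lt (by
      filter_upwards [hpos] with u hu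
      exact le_min hu.le hz.le)]
    rw [← integral_indicator measurableSet_Ioi, integral_Ioc_eq_integral_Ioo,
      ← integral_indicator measurableSet_Ioo]
    congr 1
    ext t
    by_cases h0 : 0 < t
    · by_cases htz : t < z
      · rw [indicator_of_mem (show t ∈ Ioo 0 z from ⟨h0, htz⟩),
          indicator_of_mem (show t ∈ Ioi 0 from h0)]
        simp [htz, Measure.real, Ioi]
      · rw [indicator_of_notMem (fun h : t ∈ Ioo 0 z => htz h.2),
          indicator_of_mem (show t ∈ Ioi 0 from h0)]
        simp [htz]
    · rw [indicator_of_notMem (fun h : t ∈ Ioo 0 z => h0 h.1),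
          indicator_of_notMem (show t ∉ Ioi 0 from h0)]
  have hFG : ∀ q > (0:ℝ), ∫ u, (1 - Real.exp (-q * u)) ∂ν ≤ G q := by
    intro q hq
    refine integral_mono_ae (hintexp q hq) (hintmin q hq) ?_
    filter_upwards [hpos] with u hu
    have := hup (q * u) (by positivity)
    simpa [neg_mul] using this
  have hGF : ∀ l > (0:ℝ), ∀ q > (0:ℝ),
      (1 - Real.exp (-l)) * G q ≤ Φ (l * q) := by
    intro l hl q hq
    have : (1 - Real.exp (-l)) * G q ≤ ∫ u, (1 - Real.exp (-(l * q) * u)) ∂ν := by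
      rw [hG, ← integral_const_mul]
      refine integral_mono_ae ((hintmin q hq).const_mul _) (hintexp _ (by positivity)) ?_
      filter_upwards [hpos] with u hu
      have := hlow l hl (q * u) (by positivity)
      simpa [neg_mul, mul_assoc] using this
    rw [hΦ _ (by positivity)]
    have : 0 ≤ β * (l * q) := by positivity
    linarith
  have hbeta : ∀ q > (0:ℝ), 2 * Φ q - Φ (2 * q) ≤ G q := by
    intro q hq
    have h1 : ∫ u, (1 - Real.exp (-q * u)) ∂ν ≤ ∫ u, (1 - Real.exp (-(2 * q) * u)) ∂ν := by
      refine integral_mono_ae (hintexp q hq) (hintexp _ (by positivity)) ?_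
      filter_upwards [hpos] with u hu
      have h0 : 0 < q * u := by positivity
      have : Real.exp (-(2 * q) * u) ≤ Real.exp (-q * u) := Real.exp_le_exp.2 (by nlinarith)
      linarith
    rw [hΦ _ hq.le, hΦ (2 * q) (by positivity)]
    linarith [hFG q hq]
  have hΦnn : ∀ q > (0:ℝ), 0 ≤ Φ q := by
    intro q hq
    rw [hΦ _ hq.le]
    have : 0 ≤ ∫ u, (1 - Real.exp (-q * u)) ∂ν := by
      refine integral_nonneg_of_ae ?_
      filter_upwards [hpos] with u hu
      have h0 : 0 < q * u := by positivity
      have : Real.exp (-q * u) ≤ 1 := by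
        rw [Real.exp_le_one_iff]; linarith
      simpa using this
    positivity
  have hΦpos : ∀ᶠ q in 𝓝[>] (0:ℝ), 0 < q ∧ 0 < Φ q := by
    filter_upwards [(hSV 1 one_pos).eventually_ne one_ne_zero, self_mem_nhdsWithin] with q h1 h2
    refine ⟨h2, lt_of_le_of_ne (hΦnn q h2) ?_⟩
    intro h
    rw [← h] at h1
    simp at h1
  have key : Tendsto (fun q => G q / Φ q) (𝓝[>] 0) (𝓝 1) := by
    rw [tendsto_order]
    constructor
    · intro a ha
      filter_upwards [hΦpos, (hSV 2 two_pos).eventually_lt_const (show (1:ℝ) < 2 - a by linarith)]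
        with q ⟨hq, hp⟩ h2
      rw [div_lt_iff₀ hp] at h2
      rw [lt_div_iff₀ hp]
      linarith [hbeta q hq]
    · intro a ha
      have hl : Tendsto (fun l : ℝ => (1 - Real.exp (-l)) * a) atTop (𝓝 ((1 - 0) * a)) :=
        (tendsto_const_nhds.sub Real.tendsto_exp_neg_atTop_nhds_zero).mul_const a
      obtain ⟨l, hl1, hl0⟩ := ((hl.eventually_const_lt (show (1:ℝ) < (1 - 0) * a by linarith)).and
        (eventually_gt_atTop 0)).exists
      filter_upwards [hΦpos, (hSV l hl0).eventually_lt_const hl1] with q ⟨hq, hp⟩ h2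
      rw [div_lt_iff₀ hp] at h2
      rw [div_lt_iff₀ hp]
      have h3 := hGF l hl0 q hq
      have h4 : 0 < 1 - Real.exp (-l) := by
        have : Real.exp (-l) < 1 := by rw [Real.exp_lt_one_iff]; linarith
        linarith
      refine lt_of_mul_lt_mul_left ?_ h4.le
      linarith
  have hinv : Tendsto (fun z : ℝ => 1 / z) atTop (𝓝[>] 0) := by
    simpa using tendsto_inv_atTop_nhdsGT_zero (𝕜 := ℝ)
  refine (key.comp hinv).congr' ?_
  filter_upwards [eventually_gt_atTop 0] with z hz
  rw [hlayer z hz, mul_div_mul_left _ _ hz.ne']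
  rfl
end

section
/- Let μ be a Borel measure on (0,∞) with tail μ̄(x) := μ((x,∞)) finite for every x > 0 and with ∫₀^1 μ̄(x) dx = ∞, and let γ ∈ ℝ. For a continuously differentiable f:[0,∞)→ℝ define Af(x) := ∫_{(x,∞)} (f(y) − f(x)) μ(dy) − γ·f'(x) whenever the integral is absolutely convergent. Let f:[0,∞)→ℝ be continuously differentiable with f(x) → 0 and f'(x) → 0 as x → ∞, and ∫₀^1 |f'(x)| μ̄(x) dx < ∞ (these conditions force f'(0) = 0 and make Af(x) well defined for all x ≥ 0). Then there exists a sequence (f_n) of twice continuously differentiable functions on [0,∞), each with compact support and each constant on some neighborhood of 0, such that sup_{x≥0} |f_n(x) − f(x)| → 0 and sup_{x≥0} |Af_n(x) − Af(x)| → 0 as n → ∞. -/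
open Real MeasureTheory Filter Set Topology


lemma sf (μ : Measure ℝ) (hμ0 : μ (Iic 0) = 0) (hμfin : ∀ x > (0:ℝ), μ (Ioi x) < ⊤) : SigmaFinite μ := by
  refine ⟨⟨⟨fun n : ℕ => Iic 0 ∪ Ioi (1 / ((n:ℝ) + 1)), fun _ => trivial, fun n => ?_, ?_⟩⟩⟩
  · refine (measure_union_le _ _).trans_lt ?_
    rw [hμ0, zero_add]
    exact hμfin _ (by positivity)
  · refine eq_univ_of_forall fun x => ?_
    rw [mem_iUnion]
    rcases le_or_gt x 0 with h | h
    · exact ⟨0, Or.inl h⟩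
    · obtain ⟨n, hn⟩ := exists_nat_one_div_lt h
      exact ⟨n, Or.inr hn⟩

lemma genbound (μ : Measure ℝ) [SigmaFinite μ] (g : ℝ → ℝ) (hg : ContDiff ℝ 1 g) (a : ℝ)
    (ha : ∀ x ≥ (0:ℝ), |g x| ≤ a) (x : ℝ) (hx : 0 ≤ x) :
    ∫⁻ y in Ioi x, ‖g y - g x‖ₑ ∂μ ≤
      (∫⁻ z in Ioc (0:ℝ) 1, ‖deriv g z‖ₑ * μ (Ioi z)) + ENNReal.ofReal (2 * a) * μ (Ioi 1) := by
  have hg' : Continuous (deriv g) := hg.continuous_deriv le_rfl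
  let K : ℝ → ℝ → ENNReal := fun y z => (Iio y).indicator (fun z => ‖deriv g z‖ₑ) z
  have hK : Measurable (Function.uncurry K) := by
    have : Function.uncurry K = ({p : ℝ × ℝ | p.2 < p.1}).indicator (fun p => ‖deriv g p.2‖ₑ) := by
      ext p; rfl
    rw [this]
    exact Measurable.indicator (by fun_prop) (measurableSet_lt measurable_snd measurable_fst)
  have key : ∀ y ∈ Ioi x, ‖g y - g x‖ₑ ≤
      (∫⁻ z in Ioc (0:ℝ) 1, K y z) + (Ioi (1:ℝ)).indicator (fun _ => ENNReal.ofReal (2 * a)) y := by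
    intro y hy
    have hy' : x < y := hy
    rcases le_or_gt y 1 with h1 | h1
    · refine le_trans ?_ le_self_add
      have h2 : g y - g x = ∫ z in x..y, deriv g z := by
        rw [intervalIntegral.integral_deriv_eq_sub]
        · intro z _; exact (hg.differentiable (by norm_num)) z
        · exact hg'.intervalIntegrable _ _
      rw [h2, intervalIntegral.integral_of_le hy'.le, integral_Ioc_eq_integral_Ioo]
      refine (enorm_integral_le_lintegral_enorm _).trans ?_
      calc ∫⁻ z in Ioo x y, ‖deriv g z‖ₑ = ∫⁻ z in Ioo x y, K y z := by
            refine setLIntegral_congr_fun measurableSet_Ioo fun z hz => ?_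
            simp only [K]
            rw [indicator_of_mem]
            exact hz.2
        _ ≤ ∫⁻ z in Ioc (0:ℝ) 1, K y z :=
            lintegral_mono_set (fun z hz => ⟨hx.trans_lt hz.1, hz.2.le.trans h1⟩)
    · refine le_trans ?_ le_add_self
      rw [indicator_of_mem (show y ∈ Ioi (1:ℝ) from h1), ← ofReal_norm]
      refine ENNReal.ofReal_le_ofReal ?_
      rw [Real.norm_eq_abs]
      have := abs_sub (g y) (g x)
      linarith [ha y (by linarith), ha x hx]
  calc ∫⁻ y in Ioi x, ‖g y - g x‖ₑ ∂μ
      ≤ ∫⁻ y in Ioi x, ((∫⁻ z in Ioc (0:ℝ) 1, K y z) + (Ioi (1:ℝ)).indicator (fun _ => ENNReal.ofReal (2 * a)) y) ∂μ :=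
        setLIntegral_mono' measurableSet_Ioi key
    _ ≤ ∫⁻ y, ((∫⁻ z in Ioc (0:ℝ) 1, K y z) + (Ioi (1:ℝ)).indicator (fun _ => ENNReal.ofReal (2 * a)) y) ∂μ :=
        setLIntegral_le_lintegral _ _
    _ = (∫⁻ y, (∫⁻ z in Ioc (0:ℝ) 1, K y z) ∂μ) + ENNReal.ofReal (2 * a) * μ (Ioi 1) := by
        rw [lintegral_add_right _ (measurable_const.indicator measurableSet_Ioi),
          lintegral_indicator measurableSet_Ioi, setLIntegral_const]
    _ = _ := by
        congr 1
        rw [lintegral_lintegral_swap hK.aemeasurable]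
        refine lintegral_congr fun z => ?_
        have : (fun y => K y z) = (Ioi z).indicator (fun _ => ‖deriv g z‖ₑ) := by
          ext y
          simp only [K, indicator, mem_Iio, mem_Ioi]
        rw [this, lintegral_indicator measurableSet_Ioi, setLIntegral_const]

lemma deriv0 (μ : Measure ℝ) (hμfin : ∀ x > (0:ℝ), μ (Ioi x) < ⊤)
    (hμinf : ∫⁻ x in Ioc (0:ℝ) 1, μ (Ioi x) = ⊤)
    (f' : ℝ → ℝ) (hf : Continuous f')
    (hfμ : ∫⁻ z in Ioc (0:ℝ) 1, ‖f' z‖ₑ * μ (Ioi z) ≠ ⊤) : f' 0 = 0 := by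
  by_contra h0
  have hpos : 0 < |f' 0| / 2 := by positivity
  have hev : ∀ᶠ x in 𝓝 (0:ℝ), |f' 0| / 2 < |f' x| :=
    (hf.abs.tendsto 0).eventually (lt_mem_nhds (by linarith))
  obtain ⟨δ, hδ, hball⟩ := Metric.eventually_nhds_iff.1 hev
  set c := ENNReal.ofReal (|f' 0| / 2) with hc
  have hc0 : c ≠ 0 := by simpa [hc] using h0
  have hct : c ≠ ⊤ := ENNReal.ofReal_ne_top
  have hbd : ∀ z ∈ Ioc (0:ℝ) 1, μ (Ioi z) ≤ c⁻¹ * (‖f' z‖ₑ * μ (Ioi z)) + μ (Ioi (δ/2)) := by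
    intro z hz
    rcases lt_or_ge z δ with h | h
    · refine le_trans ?_ le_self_add
      rw [← mul_assoc]
      refine le_mul_of_one_le_left (zero_le) ?_
      rw [← ENNReal.inv_mul_cancel hc0 hct]
      gcongr
      rw [hc, ← ofReal_norm]
      refine ENNReal.ofReal_le_ofReal (hball ?_).le
      rw [Real.dist_eq, sub_zero, abs_of_pos hz.1]; exact h
    · exact le_trans (measure_mono (Ioi_subset_Ioi (by linarith))) le_add_self
  have := setLIntegral_mono' (μ := volume) measurableSet_Ioc hbd
  rw [hμinf, lintegral_add_right _ measurable_const, lintegral_const_mul' _ _ (by simpa using hc0),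
    setLIntegral_const, top_le_iff] at this
  revert this
  refine ENNReal.add_ne_top.2 ⟨ENNReal.mul_ne_top (by simpa using hc0) hfμ, ENNReal.mul_ne_top (hμfin _ (by linarith)).ne (by simp)⟩

lemma step1 (μ : Measure ℝ) 
    (f : ℝ → ℝ) (hf : ContDiff ℝ 1 f) (h0 : deriv f 0 = 0)
    (hfμ : ∫⁻ z in Ioc (0:ℝ) 1, ‖deriv f z‖ₑ * μ (Ioi z) ≠ ⊤) (ε : ℝ) (hε : 0 < ε) :
    ∃ (G : ℝ → ℝ) (δ : ℝ), 0 < δ ∧ ContDiff ℝ 1 G ∧ (∀ x ≤ δ, deriv G x = 0) ∧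
      (∀ x ≥ 1, G x = f x) ∧ (∀ x ≥ 1, deriv G x = deriv f x) ∧
      (∀ x ≥ 0, |G x - f x| ≤ ε) ∧ (∀ x ≥ 0, |deriv G x - deriv f x| ≤ ε) ∧
      ∫⁻ z in Ioc (0:ℝ) 1, ‖deriv G z - deriv f z‖ₑ * μ (Ioi z) ≤ ENNReal.ofReal ε := by
  have hf' : Continuous (deriv f) := hf.continuous_deriv le_rfl
  obtain ⟨δ, hδ, hδ1, hδs, hδi⟩ : ∃ δ : ℝ, 0 < δ ∧ 2 * δ ≤ 1 ∧ (∀ x ∈ Icc 0 (2 * δ), |deriv f x| ≤ ε) ∧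
      ∫⁻ z in Ioc (0:ℝ) (2 * δ), ‖deriv f z‖ₑ * μ (Ioi z) ≤ ENNReal.ofReal ε := by
    have e1 : ∀ᶠ δ in 𝓝[>] (0:ℝ), 2 * δ ≤ 1 := by
      filter_upwards [Ioo_mem_nhdsGT (show (0:ℝ) < 1/2 by norm_num)] with d hd
      linarith [hd.2]
    have e2 : ∀ᶠ δ in 𝓝[>] (0:ℝ), ∀ x ∈ Icc 0 (2 * δ), |deriv f x| ≤ ε := by
      have hev : ∀ᶠ x in 𝓝 (0:ℝ), |deriv f x| < ε :=
        (hf'.abs.tendsto 0).eventually (gt_mem_nhds (by simpa [h0] using hε))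
      obtain ⟨δ, hδ, hball⟩ := Metric.eventually_nhds_iff.1 hev
      filter_upwards [Ioo_mem_nhdsGT (show (0:ℝ) < δ/2 by linarith)] with d hd x hx
      refine (hball ?_).le
      rw [Real.dist_eq, sub_zero, abs_of_nonneg hx.1]
      linarith [hd.2, hx.2]
    have e3 : ∀ᶠ δ in 𝓝[>] (0:ℝ), ∫⁻ z in Ioc (0:ℝ) (2 * δ), ‖deriv f z‖ₑ * μ (Ioi z) ≤ ENNReal.ofReal ε := by
      have ht : Tendsto (fun δ : ℝ => (volume.restrict (Ioc (0:ℝ) 1)) (Ioc 0 (2 * δ))) (𝓝[>] 0) (𝓝 0) := by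
        refine tendsto_of_tendsto_of_tendsto_of_le_of_le tendsto_const_nhds (h := fun δ : ℝ => ENNReal.ofReal (2 * δ)) ?_ (fun _ => zero_le) ?_
        · have : Continuous (fun δ : ℝ => ENNReal.ofReal (2 * δ)) :=
            ENNReal.continuous_ofReal.comp (by fun_prop)
          have h := this.tendsto 0
          simp only [mul_zero, ENNReal.ofReal_zero] at h
          exact h.mono_left nhdsWithin_le_nhds
        · intro d
          refine (Measure.restrict_apply_le _ _).trans ?_
          simp
      have h := tendsto_setLIntegral_zero hfμ ht
      have h2 := h.eventually (gt_mem_nhds (ENNReal.ofReal_pos.2 hε))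
      filter_upwards [h2, e1] with d hd hd1
      rw [Measure.restrict_restrict measurableSet_Ioc, inter_eq_left.2 (Ioc_subset_Ioc le_rfl hd1)] at hd
      exact hd.le
    obtain ⟨d, h1, h2, h3, h4⟩ := (e1.and (e2.and (e3.and self_mem_nhdsWithin))).exists
    exact ⟨d, h4, h1, h2, h3⟩
  let χ : ℝ → ℝ := fun x => smoothTransition ((x - δ) / δ)
  have hχ : Continuous χ := smoothTransition.continuous.comp (by fun_prop)
  have hχ0 : ∀ x ≤ δ, χ x = 0 := fun x hx => smoothTransition.zero_of_nonpos
    (div_nonpos_of_nonpos_of_nonneg (by linarith) hδ.le)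
  have hχ1 : ∀ x ≥ 2 * δ, χ x = 1 := fun x hx => smoothTransition.one_of_one_le
    ((one_le_div hδ).2 (by linarith))
  have hχb : ∀ x, |1 - χ x| ≤ 1 := fun x => by
    have h1 := smoothTransition.nonneg ((x - δ) / δ)
    have h2 := smoothTransition.le_one ((x - δ) / δ)
    rw [abs_le]; constructor <;> simp only [χ] <;> linarith
  have hk : Continuous fun z => deriv f z * (1 - χ z) := by fun_prop
  let k : ℝ → ℝ := fun x => ∫ z in (2*δ)..x, deriv f z * (1 - χ z)
  have hkd : ∀ x, HasDerivAt k (deriv f x * (1 - χ x)) x := fun x =>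
    hk.integral_hasStrictDerivAt _ _ |>.hasDerivAt
  have hGd : ∀ x, HasDerivAt (fun x => f x - k x) (deriv f x * χ x) x := fun x => by
    have := ((hf.differentiable (by norm_num) x).hasDerivAt).fun_sub (hkd x)
    exact this.congr_deriv (by ring)
  have hG' : deriv (fun x => f x - k x) = fun x => deriv f x * χ x := funext fun x => (hGd x).deriv
  have hkb : ∀ x ≥ 0, |deriv f x * (1 - χ x)| ≤ ε := by
    intro x hx
    rcases le_total x (2 * δ) with h | h
    · rw [abs_mul]
      calc _ ≤ ε * 1 := by
            gcongr
            exacts [hδs x ⟨hx, h⟩, hχb x]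
        _ = ε := mul_one _
    · rw [hχ1 x h]; simpa using hε.le
  have hk0 : ∀ x ≥ 2 * δ, k x = 0 := by
    intro x hx
    have : ∀ z ∈ uIcc (2*δ) x, deriv f z * (1 - χ z) = 0 := by
      intro z hz
      rw [uIcc_of_le hx] at hz
      rw [hχ1 z hz.1]; simp
    simp only [k]
    rw [intervalIntegral.integral_congr this]; simp
  have hdiff : ∀ x, deriv f x * χ x - deriv f x = - (deriv f x * (1 - χ x)) := fun x => by ring
  refine ⟨fun x => f x - k x, δ, hδ, ?_, ?_, ?_, ?_, ?_, ?_, ?_⟩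
  · rw [contDiff_one_iff_deriv]
    refine ⟨fun x => (hGd x).differentiableAt, ?_⟩
    rw [hG']; fun_prop
  · intro x hx; rw [hG']; simp [hχ0 x hx]
  · intro x hx; simp [hk0 x (hδ1.trans hx)]
  · intro x hx; rw [hG']; simp [hχ1 x (hδ1.trans hx)]
  · intro x hx
    have : f x - k x - f x = - k x := by ring
    rw [this, abs_neg]
    rcases le_total x (2 * δ) with h | h
    · have := intervalIntegral.norm_integral_le_of_norm_le_const (a := 2 * δ) (b := x) (C := ε)
        (f := fun z => deriv f z * (1 - χ z)) (by
          intro z hz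
          rw [uIoc_of_ge h] at hz
          exact hkb z (hx.trans hz.1.le))
      refine le_trans this ?_
      have h2 : |x - 2 * δ| ≤ 1 := by rw [abs_le]; constructor <;> linarith
      nlinarith
    · rw [hk0 x h]; simpa using hε.le
  · intro x hx
    rw [hG']
    simp only [hdiff, abs_neg]
    exact hkb x hx
  · rw [hG']
    refine le_trans ?_ hδi
    simp only [hdiff, enorm_neg]
    rw [← lintegral_indicator measurableSet_Ioc, ← lintegral_indicator measurableSet_Ioc]
    refine lintegral_mono fun z => ?_
    by_cases hz : z ∈ Ioc (0:ℝ) 1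
    · rw [indicator_of_mem hz]
      by_cases hz2 : z ≤ 2 * δ
      · rw [indicator_of_mem (show z ∈ Ioc 0 (2*δ) from ⟨hz.1, hz2⟩)]
        gcongr
        rw [enorm_mul]
        refine mul_le_of_le_one_right zero_le ?_
        rw [← ofReal_norm]
        exact ENNReal.ofReal_le_one.2 (hχb z)
      · rw [hχ1 z (not_le.1 hz2).le]; simp
    · rw [indicator_of_notMem hz]; exact zero_le

lemma step2 (f : ℝ → ℝ) (hf : ContDiff ℝ 1 f) (hf0 : Tendsto f atTop (𝓝 0))
    (hf'0 : Tendsto (deriv f) atTop (𝓝 0)) (ε : ℝ) (hε : 0 < ε) :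
    ∃ G : ℝ → ℝ, ContDiff ℝ 1 G ∧ HasCompactSupport G ∧
      (∀ x ∈ Icc (0:ℝ) 1, deriv G x = deriv f x) ∧
      (∀ x ≥ 0, |G x - f x| ≤ ε) ∧ (∀ x ≥ 0, |deriv G x - deriv f x| ≤ ε) := by
  let ψ : ContDiffBump (0:ℝ) := ⟨1, 2, by norm_num, by norm_num⟩
  have hψd : ContDiff ℝ 1 (ψ : ℝ → ℝ) := ψ.contDiff
  obtain ⟨C, hC⟩ := (ψ.hasCompactSupport.deriv).exists_bound_of_continuous (hψd.continuous_deriv le_rfl)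
  have hC0 : 0 ≤ C := (norm_nonneg _).trans (hC 0)
  set η := ε / (1 + C) with hη
  have hηp : 0 < η := by positivity
  have hηε : η * (1 + C) = ε := by rw [hη]; field_simp
  have e1 := hf0.abs.eventually (gt_mem_nhds (show |(0:ℝ)| < η by simpa using hηp))
  have e2 := hf'0.abs.eventually (gt_mem_nhds (show |(0:ℝ)| < η by simpa using hηp))
  obtain ⟨R0, hR0⟩ := eventually_atTop.1 (e1.and e2)
  set R := max R0 2 with hR
  have hR2 : 2 ≤ R := le_max_right _ _
  have hRp : 0 < R := by linarith
  let p : ℝ → ℝ := fun x => ψ (x / R)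
  have hp : ContDiff ℝ 1 p := hψd.comp (contDiff_id.div_const R)
  have hpd : ∀ x, HasDerivAt p (deriv ψ (x / R) / R) x := by
    intro x
    have h1 := (hψd.differentiable (by norm_num) (x / R)).hasDerivAt
    have h2 := (hasDerivAt_id x).div_const R
    have := h1.comp x h2
    exact this.congr_deriv (by ring)
  have hpb : ∀ x, |deriv p x| ≤ C := by
    intro x
    rw [(hpd x).deriv, abs_div, abs_of_pos hRp]
    have := hC (x / R)
    rw [Real.norm_eq_abs] at this
    exact (div_le_self (abs_nonneg _) (by linarith)).trans this
  have hp1 : ∀ x ∈ Icc (-R) R, p x = 1 := by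
    intro x hx
    refine ψ.one_of_mem_closedBall ?_
    rw [mem_closedBall_zero_iff, Real.norm_eq_abs, abs_div, abs_of_pos hRp, div_le_one hRp]
    exact abs_le.2 hx
  have hpm : ∀ x, |p x - 1| ≤ 1 := by
    intro x
    have h1 : 0 ≤ p x := ψ.nonneg
    have h2 : p x ≤ 1 := ψ.le_one
    rw [abs_le]; constructor <;> linarith
  have hGd : ∀ x, deriv (fun x => f x * p x) x = deriv f x * p x + f x * deriv p x := fun x =>
    deriv_fun_mul (hf.differentiable (by norm_num) x) (hp.differentiable (by norm_num) x)
  have hp'1 : ∀ x ∈ Ioo (-R) R, deriv p x = 0 := by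
    intro x hx
    have : p =ᶠ[𝓝 x] fun _ => 1 := by
      filter_upwards [Ioo_mem_nhds hx.1 hx.2] with y hy
      exact hp1 y ⟨hy.1.le, hy.2.le⟩
    rw [this.deriv_eq]; simp
  refine ⟨fun x => f x * p x, hf.mul hp, ?_, ?_, ?_, ?_⟩
  · refine HasCompactSupport.mul_left ?_
    refine HasCompactSupport.intro (isCompact_Icc (a := -(2*R)) (b := 2*R)) ?_
    intro x hx
    refine ψ.zero_of_le_dist ?_
    rw [Real.dist_eq, sub_zero, abs_div, abs_of_pos hRp, le_div_iff₀ hRp]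
    by_contra! h
    exact hx (abs_le.1 h.le)
  · intro x hx
    rw [hGd, hp1 x ⟨by linarith [hx.1], by linarith [hx.2]⟩, hp'1 x ⟨by linarith [hx.1], by linarith [hx.2]⟩]
    simp
  · intro x hx
    have : f x * p x - f x = f x * (p x - 1) := by ring
    simp only [this, abs_mul]
    rcases le_or_gt x R with h | h
    · rw [hp1 x ⟨by linarith, h⟩]; simpa using hε.le
    · have h1 := (hR0 x ((le_max_left _ _).trans h.le)).1
      nlinarith [hpm x, abs_nonneg (f x), abs_nonneg (p x - 1)]
  · intro x hx
    rw [hGd]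
    have : deriv f x * p x + f x * deriv p x - deriv f x = deriv f x * (p x - 1) + f x * deriv p x := by ring
    rw [this]
    rcases lt_or_ge x R with h | h
    · rw [hp1 x ⟨by linarith, h.le⟩, hp'1 x ⟨by linarith, h⟩]; simpa using hε.le
    · have h1 := (hR0 x ((le_max_left _ _).trans h))
      refine (abs_add_le _ _).trans ?_
      rw [abs_mul, abs_mul]
      have a1 : |deriv f x| * |p x - 1| ≤ η * 1 := by
        gcongr
        exacts [h1.2.le, hpm x]
      have a2 : |f x| * |deriv p x| ≤ η * C := by
        gcongr
        exacts [h1.1.le, hpb x]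
      linarith

lemma step3 (f : ℝ → ℝ) (hf : ContDiff ℝ 1 f) (hc : HasCompactSupport f)
    (δ : ℝ) (hδ : 0 < δ) (hfδ : ∀ x ∈ Icc 0 δ, f x = f 0) (ε : ℝ) (hε : 0 < ε) :
    ∃ G : ℝ → ℝ, ContDiff ℝ 2 G ∧ HasCompactSupport G ∧
      (∀ x ∈ Icc 0 (δ / 2), G x = G 0) ∧ (∀ x ∈ Icc 0 (δ / 2), deriv G x = 0) ∧
      (∀ x, |G x - f x| ≤ ε) ∧ (∀ x, |deriv G x - deriv f x| ≤ ε) := by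
  have hf' : Continuous (deriv f) := hf.continuous_deriv le_rfl
  have hdf : ∀ x, HasDerivAt f (deriv f x) x := fun x => (hf.differentiable (by norm_num) x).hasDerivAt
  have u1 := hc.uniformContinuous_of_continuous hf.continuous
  have u2 := hc.deriv.uniformContinuous_of_continuous hf'
  obtain ⟨d1, hd1, h1⟩ := Metric.uniformContinuous_iff.1 u1 ε hε
  obtain ⟨d2, hd2, h2⟩ := Metric.uniformContinuous_iff.1 u2 ε hε
  obtain ⟨r, hr, hrd, hrd1, hrd2⟩ : ∃ r : ℝ, 0 < r ∧ r ≤ δ / 2 ∧ r ≤ d1 ∧ r ≤ d2 :=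
    ⟨min (δ / 2) (min d1 d2), by positivity, min_le_left _ _,
      (min_le_right _ _).trans (min_le_left _ _), (min_le_right _ _).trans (min_le_right _ _)⟩
  let Φ : ℝ → ℝ := fun x => ∫ z in (0:ℝ)..x, f z
  have hΦ : ∀ x, HasDerivAt Φ (f x) x := fun x =>
    (hf.continuous.integral_hasStrictDerivAt _ _).hasDerivAt
  let G : ℝ → ℝ := fun x => (Φ (x + r) - Φ x) / r
  have hG : ∀ x, HasDerivAt G ((f (x + r) - f x) / r) x := fun x =>
    (((hΦ (x + r)).comp_add_const x r).sub (hΦ x)).div_const r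
  have hG' : deriv G = fun x => (f (x + r) - f x) / r := funext fun x => (hG x).deriv
  have hmv1 : ∀ x, ∃ c ∈ Ioo x (x + r), f c = G x := by
    intro x
    obtain ⟨c, hc, h⟩ := exists_hasDerivAt_eq_slope Φ f (by linarith : x < x + r)
      (fun y _ => (hΦ y).continuousAt.continuousWithinAt) (fun y _ => hΦ y)
    refine ⟨c, hc, ?_⟩
    rw [h]; simp [G]
  have hmv2 : ∀ x, ∃ c ∈ Ioo x (x + r), deriv f c = deriv G x := by
    intro x
    obtain ⟨c, hc, h⟩ := exists_hasDerivAt_eq_slope f (deriv f) (by linarith : x < x + r)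
      (fun y _ => (hdf y).continuousAt.continuousWithinAt) (fun y _ => hdf y)
    refine ⟨c, hc, ?_⟩
    rw [h, hG']; simp
  have hG0 : ∀ x ∈ Icc 0 (δ / 2), G x = f 0 := by
    intro x hx
    obtain ⟨c, hc, h⟩ := hmv1 x
    rw [← h]
    exact hfδ c ⟨hx.1.trans hc.1.le, by linarith [hx.2, hc.2]⟩
  refine ⟨G, ?_, ?_, ?_, ?_, ?_, ?_⟩
  · rw [show (2 : WithTop ℕ∞) = 1 + 1 by norm_num, contDiff_succ_iff_deriv]
    refine ⟨fun x => (hG x).differentiableAt, by simp, ?_⟩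
    rw [hG']
    exact ((hf.comp (contDiff_id.add contDiff_const)).sub hf).div_const r
  · obtain ⟨M, hM⟩ := hc.isCompact.isBounded.subset_closedBall (0:ℝ)
    refine HasCompactSupport.intro (isCompact_closedBall (0:ℝ) (M + r)) ?_
    intro x hx
    obtain ⟨c, hc, h⟩ := hmv1 x
    rw [← h]
    by_contra hne
    have := hM (subset_tsupport f hne)
    rw [mem_closedBall_zero_iff, Real.norm_eq_abs, abs_le] at this hx
    exact hx ⟨by linarith [hc.2], by linarith [hc.1]⟩
  · intro x hx
    rw [hG0 x hx, hG0 0 ⟨le_rfl, by linarith⟩]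
  · intro x hx
    rw [hG']
    simp only
    rw [hfδ (x + r) ⟨by linarith [hx.1], by linarith [hx.2]⟩, hfδ x ⟨hx.1, by linarith [hx.2]⟩]
    simp
  · intro x
    obtain ⟨c, hc, h⟩ := hmv1 x
    rw [← h]
    refine (h1 ?_).le
    rw [Real.dist_eq, abs_lt]; constructor <;> linarith [hc.1, hc.2]
  · intro x
    obtain ⟨c, hc, h⟩ := hmv2 x
    rw [← h]
    refine (h2 ?_).le
    rw [Real.dist_eq, abs_lt]; constructor <;> linarith [hc.1, hc.2]

lemma approx (μ : Measure ℝ) (hμfin : ∀ x > (0:ℝ), μ (Ioi x) < ⊤)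
    (f : ℝ → ℝ) (hf : ContDiff ℝ 1 f) (h0 : deriv f 0 = 0)
    (hf0 : Tendsto f atTop (𝓝 0)) (hf'0 : Tendsto (deriv f) atTop (𝓝 0))
    (hfμ : ∫⁻ z in Ioc (0:ℝ) 1, ‖deriv f z‖ₑ * μ (Ioi z) ≠ ⊤) (ε : ℝ) (hε : 0 < ε) :
    ∃ G : ℝ → ℝ, ContDiff ℝ 2 G ∧ HasCompactSupport G ∧
      (∃ δ > (0:ℝ), ∀ x ∈ Icc (0:ℝ) δ, G x = G 0) ∧
      (∀ x ≥ 0, |G x - f x| ≤ ε) ∧ (∀ x ≥ 0, |deriv G x - deriv f x| ≤ ε) ∧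
      ∫⁻ z in Ioc (0:ℝ) 1, ‖deriv G z - deriv f z‖ₑ * μ (Ioi z) ≤ ENNReal.ofReal ε := by
  obtain ⟨f1, δ0, hδ0, c1, z1, e1, e1', b1, b1', i1⟩ := step1 μ f hf h0 hfμ (ε / 3) (by positivity)
  have t1 : Tendsto f1 atTop (𝓝 0) := hf0.congr' (by
    filter_upwards [eventually_ge_atTop 1] with x hx using (e1 x hx).symm)
  have t1' : Tendsto (deriv f1) atTop (𝓝 0) := hf'0.congr' (by
    filter_upwards [eventually_ge_atTop 1] with x hx using (e1' x hx).symm)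
  obtain ⟨f2, c2, k2, e2, b2, b2'⟩ := step2 f1 c1 t1 t1' (ε / 3) (by positivity)
  set δ := min δ0 1 with hδdef
  have hδ : 0 < δ := by positivity
  have z2 : ∀ x ∈ Icc 0 δ, deriv f2 x = 0 := fun x hx => by
    rw [e2 x ⟨hx.1, hx.2.trans (min_le_right _ _)⟩, z1 x (hx.2.trans (min_le_left _ _))]
  have const2 : ∀ x ∈ Icc 0 δ, f2 x = f2 0 := by
    have hd := c2.differentiable (by norm_num)
    refine constant_of_has_deriv_right_zero hd.continuous.continuousOn ?_
    intro x hx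
    have := (hd x).hasDerivAt
    rw [z2 x ⟨hx.1, hx.2.le⟩] at this
    exact this.hasDerivWithinAt
  set m := (μ (Ioi (δ / 2))).toReal with hm
  have hm0 : 0 ≤ m := ENNReal.toReal_nonneg
  set η := ε / 3 / (1 + m) with hη
  have hηp : 0 < η := by positivity
  have hηε : η * (1 + m) = ε / 3 := by rw [hη]; field_simp
  have hηm : η * m ≤ ε / 3 := by nlinarith
  have hη3 : η ≤ ε / 3 := by nlinarith
  obtain ⟨G, c3, k3, const3, z3, b3, b3'⟩ := step3 f2 c2 k2 δ hδ const2 η hηp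
  refine ⟨G, c3, k3, ⟨δ / 2, by positivity, const3⟩, ?_, ?_, ?_⟩
  · intro x hx
    have h1 := abs_le.1 (b1 x hx)
    have h2 := abs_le.1 (b2 x hx)
    have h3 := abs_le.1 (b3 x)
    rw [abs_le]; constructor <;> linarith [h1.1, h1.2, h2.1, h2.2, h3.1, h3.2]
  · intro x hx
    have h1 := abs_le.1 (b1' x hx)
    have h2 := abs_le.1 (b2' x hx)
    have h3 := abs_le.1 (b3' x)
    rw [abs_le]; constructor <;> linarith [h1.1, h1.2, h2.1, h2.2, h3.1, h3.2]
  · have hb : ∀ z ∈ Ioc (0:ℝ) 1, ‖deriv G z - deriv f z‖ₑ * μ (Ioi z) ≤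
        ‖deriv f1 z - deriv f z‖ₑ * μ (Ioi z) + ENNReal.ofReal (ε / 3) := by
      intro z hz
      rw [← e2 z ⟨hz.1.le, hz.2⟩]
      rcases le_total z (δ / 2) with h | h
      · rw [z3 z ⟨hz.1.le, h⟩, z2 z ⟨hz.1.le, by linarith⟩]
        exact le_self_add
      · have : deriv G z - deriv f z = (deriv f2 z - deriv f z) + (deriv G z - deriv f2 z) := by ring
        rw [this]
        refine (mul_le_mul_left (enorm_add_le _ _) _).trans ?_
        rw [add_mul]
        gcongr
        calc ‖deriv G z - deriv f2 z‖ₑ * μ (Ioi z) ≤ ENNReal.ofReal η * μ (Ioi (δ / 2)) := by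
              gcongr
              rw [← ofReal_norm]
              exact ENNReal.ofReal_le_ofReal (b3' z)
          _ = ENNReal.ofReal (η * m) := by
              rw [ENNReal.ofReal_mul hηp.le, hm, ENNReal.ofReal_toReal (hμfin _ (by positivity)).ne]
          _ ≤ _ := ENNReal.ofReal_le_ofReal hηm
    refine (setLIntegral_mono' measurableSet_Ioc hb).trans ?_
    rw [lintegral_add_right _ measurable_const, setLIntegral_const]
    calc _ ≤ ENNReal.ofReal (ε / 3) + ENNReal.ofReal (ε / 3) := by
          gcongr
          simp
      _ = ENNReal.ofReal (ε / 3 + ε / 3) := (ENNReal.ofReal_add (by positivity) (by positivity)).symm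
      _ ≤ _ := ENNReal.ofReal_le_ofReal (by linarith)

/-- approximation of functions in the ESN core by `C²` compactly
supported functions constant near 0, uniformly together with the generator. -/
theorem stmt_8
    (μ : Measure ℝ)
    (hμ0 : μ (Iic 0) = 0)
    (hμfin : ∀ x > (0:ℝ), μ (Ioi x) < ⊤)
    (hμinf : ∫⁻ x in Ioc (0:ℝ) 1, μ (Ioi x) = ⊤)
    (γ : ℝ)
    (f : ℝ → ℝ) (hf : ContDiff ℝ 1 f)
    (hf0 : Tendsto f atTop (𝓝 0))
    (hf'0 : Tendsto (deriv f) atTop (𝓝 0))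
    (hfμ : IntegrableOn (fun x => |deriv f x| * (μ (Ioi x)).toReal) (Ioc 0 1))
    (hfint : ∀ x ≥ (0:ℝ), IntegrableOn (fun y => f y - f x) (Ioi x) μ) :
    ∃ F : ℕ → ℝ → ℝ,
      (∀ n, ContDiff ℝ 2 (F n) ∧ HasCompactSupport (F n) ∧
        ∃ ε > (0:ℝ), ∀ x ∈ Icc (0:ℝ) ε, F n x = F n 0) ∧
      (∀ η > (0:ℝ), ∃ N : ℕ, ∀ n ≥ N, ∀ x ≥ (0:ℝ),
        |F n x - f x| < η ∧
        |((∫ y in Ioi x, (F n y - F n x) ∂μ) - γ * deriv (F n) x) -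
            ((∫ y in Ioi x, (f y - f x) ∂μ) - γ * deriv f x)| < η) := by
  have := sf μ hμ0 hμfin
  have hf' : Continuous (deriv f) := hf.continuous_deriv le_rfl
  have hfμ' : ∫⁻ z in Ioc (0:ℝ) 1, ‖deriv f z‖ₑ * μ (Ioi z) ≠ ⊤ := by
    have h := hfμ.2
    rw [hasFiniteIntegral_iff_enorm] at h
    refine ne_of_lt (lt_of_le_of_lt (le_of_eq ?_) h)
    refine setLIntegral_congr_fun measurableSet_Ioc fun z hz => ?_
    simp only [enorm_mul, Real.enorm_abs]
    rw [Real.enorm_of_nonneg ENNReal.toReal_nonneg, ENNReal.ofReal_toReal (hμfin z hz.1).ne]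
  have h0 := deriv0 μ hμfin hμinf (deriv f) hf' hfμ'
  set m := (μ (Ioi 1)).toReal with hm
  have hm0 : 0 ≤ m := ENNReal.toReal_nonneg
  set K := 1 + 2 * m + |γ| with hK
  have hKp : 0 < K := by positivity
  have main : ∀ n : ℕ, ∃ G : ℝ → ℝ, (ContDiff ℝ 2 G ∧ HasCompactSupport G ∧
      ∃ δ > (0:ℝ), ∀ x ∈ Icc (0:ℝ) δ, G x = G 0) ∧
      ∀ x ≥ (0:ℝ), |G x - f x| ≤ 1 / ((n:ℝ) + 1) ∧
        |((∫ y in Ioi x, (G y - G x) ∂μ) - γ * deriv G x) -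
            ((∫ y in Ioi x, (f y - f x) ∂μ) - γ * deriv f x)| ≤ K * (1 / ((n:ℝ) + 1)) := by
    intro n
    set ε := 1 / ((n:ℝ) + 1) with hεd
    have hε : 0 < ε := by positivity
    obtain ⟨G, c, k, e, b, b', i⟩ := approx μ hμfin f hf h0 hf0 hf'0 hfμ' ε hε
    refine ⟨G, ⟨c, k, e⟩, fun x hx => ⟨b x hx, ?_⟩⟩
    have c1 : ContDiff ℝ 1 G := c.of_le (by norm_num)
    have hgd : ∀ z, deriv (fun x => G x - f x) z = deriv G z - deriv f z := fun z =>
      deriv_fun_sub (c1.differentiable (by norm_num) z) (hf.differentiable (by norm_num) z)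
    have hb := genbound μ (fun x => G x - f x) (c1.sub hf) ε b x hx
    simp only [hgd] at hb
    have hb2 : ∫⁻ y in Ioi x, ‖(G y - f y) - (G x - f x)‖ₑ ∂μ ≤ ENNReal.ofReal (ε + 2 * ε * m) := by
      refine hb.trans ?_
      rw [ENNReal.ofReal_add hε.le (by positivity), ENNReal.ofReal_mul (p := 2 * ε) (by positivity), hm,
        ENNReal.ofReal_toReal (hμfin 1 one_pos).ne]
      gcongr
    have hint : IntegrableOn (fun y => (G y - f y) - (G x - f x)) (Ioi x) μ := by
      refine ⟨?_, ?_⟩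
      · exact (((c1.continuous.sub hf.continuous).sub continuous_const).measurable).aestronglyMeasurable
      · rw [hasFiniteIntegral_iff_enorm]
        exact hb2.trans_lt ENNReal.ofReal_lt_top
    have hGeq : (∫ y in Ioi x, (G y - G x) ∂μ) =
        (∫ y in Ioi x, ((G y - f y) - (G x - f x)) ∂μ) + ∫ y in Ioi x, (f y - f x) ∂μ := by
      rw [← integral_add hint (hfint x hx)]
      congr 1; ext y; ring
    have hI : |∫ y in Ioi x, ((G y - f y) - (G x - f x)) ∂μ| ≤ ε + 2 * ε * m := by
      have h := (enorm_integral_le_lintegral_enorm (μ := μ.restrict (Ioi x))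
        (fun y => (G y - f y) - (G x - f x))).trans hb2
      rw [← ofReal_norm, ENNReal.ofReal_le_ofReal_iff (by positivity)] at h
      exact h
    rw [hGeq]
    have h3 : |γ * (deriv G x - deriv f x)| ≤ |γ| * ε := by
      rw [abs_mul]
      gcongr
      exact b' x hx
    have a1 := abs_le.1 hI
    have a2 := abs_le.1 h3
    have hKε : K * ε = ε + 2 * ε * m + |γ| * ε := by rw [hK]; ring
    rw [hKε, abs_le]
    constructor <;> linarith [a1.1, a1.2, a2.1, a2.2]
  choose F hF1 hF2 using main
  refine ⟨F, hF1, fun η hη => ?_⟩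
  obtain ⟨N, hN⟩ := exists_nat_one_div_lt (show 0 < η / K by positivity)
  refine ⟨N, fun n hn x hx => ?_⟩
  have hn1 : 1 / ((n:ℝ) + 1) < η / K := lt_of_le_of_lt (by gcongr) hN
  have hn2 : K * (1 / ((n:ℝ) + 1)) < η := by
    rw [lt_div_iff₀ hKp] at hn1; linarith
  have hK1 : 1 ≤ K := by linarith [abs_nonneg γ]
  have hp : 0 < 1 / ((n:ℝ) + 1) := by positivity
  obtain ⟨p, q⟩ := hF2 n x hx
  exact ⟨p.trans_lt (by nlinarith), q.trans_lt hn2⟩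
end
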